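/- arXiv:2203.00521 — 2 statements merged into one kernel-verified Lean document; each statement's English description precedes it below -/
import Mathlib

section
/- Let D be a DAG on a finite vertex set V and let u, v be distinct nodes that are nonadjacent in D but adjacent in the unconditional dependence graph U^D. Then neither (u, v) nor (v, u) is partially weakly covered or implied by transitivity in D if and only if u ∉ an_D(v), v ∉ an_D(u), and there exist source nodes m′ and m″ of D such that u ∈ de_D(m′) but v ∉ de_D(m′), and v ∈ de_D(m″) but u ∉ de_D(m″). -/
namespace UEC

variable {V : Type*}

/-- A directed graph is a DAG if it has no directed cycles. -/
def IsDAG (D : Digraph V) : Prop := ∀ v : V, ¬ Relation.TransGen D.Adj v v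

/-- `an D v` : the set of ancestors of `v` (nodes with a directed path to `v`),
including `v` itself. -/
def an (D : Digraph V) (v : V) : Set V := {u | Relation.ReflTransGen D.Adj u v}

/-- `de D v` : the set of descendants of `v` (nodes reachable by a directed path
from `v`), including `v` itself. -/
def de (D : Digraph V) (v : V) : Set V := {u | Relation.ReflTransGen D.Adj v u}

/-- `pa D v` : the set of parents of `v`. -/
def pa (D : Digraph V) (v : V) : Set V := {u | D.Adj u v}

/-- A source node is a node with no parents. -/
def IsSource (D : Digraph V) (v : V) : Prop := pa D v = ∅

/-- `sources D` : the set of source nodes of `D` (denoted `ma_D(V)` in the paper). -/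
def sources (D : Digraph V) : Set V := {v | IsSource D v}

/-- Ancestors of a set of nodes. -/
def anSet (D : Digraph V) (A : Set V) : Set V := ⋃ a ∈ A, an D a

/-- `maSet D A = {u ∈ an_D(A) : an_D(u) = {u}}`, the source nodes that are
ancestors of `A`. -/
def maSet (D : Digraph V) (A : Set V) : Set V :=
  {u | u ∈ anSet D A ∧ an D u = {u}}

/-- Two nodes are adjacent in a digraph if there is an edge between them in
either direction. -/
def Adjacent (D : Digraph V) (v w : V) : Prop := D.Adj v w ∨ D.Adj w v

/-- A trek in `D` is a path over distinct vertices (given as the list of its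
vertices, consecutive ones being adjacent) containing no collider
`p i → p (i+1) ← p (i+2)` as a subpath. -/
def IsTrekList (D : Digraph V) (p : List V) : Prop :=
  p.Nodup ∧
    (∀ i : ℕ, (h : i + 1 < p.length) →
      (D.Adj (p.get ⟨i, by omega⟩) (p.get ⟨i + 1, h⟩) ∨
        D.Adj (p.get ⟨i + 1, h⟩) (p.get ⟨i, by omega⟩))) ∧
    (∀ i : ℕ, (h : i + 2 < p.length) →
      ¬(D.Adj (p.get ⟨i, by omega⟩) (p.get ⟨i + 1, by omega⟩) ∧
        D.Adj (p.get ⟨i + 2, h⟩) (p.get ⟨i + 1, by omega⟩)))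

/-- There is a trek between `v` and `w` in `D`. -/
def HasTrek (D : Digraph V) (v w : V) : Prop :=
  ∃ p : List V, IsTrekList D p ∧ p.head? = some v ∧ p.getLast? = some w

/-- Adjacency in the unconditional dependence graph `U^D` : two distinct nodes
are adjacent iff there is a trek between them. -/
def UAdj (D : Digraph V) (v w : V) : Prop :=
  v ≠ w ∧ (HasTrek D v w ∨ HasTrek D w v)

/-- Two digraphs on the same vertex set are unconditionally equivalent if for
all distinct nodes there is a trek between them in one iff there is one in the
other. -/
def UncondEquiv (D D' : Digraph V) : Prop :=
  ∀ v w : V, v ≠ w → (HasTrek D v w ↔ HasTrek D' v w)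

/-- The digraph obtained by adding the edge `v → w`. -/
def addEdge (D : Digraph V) (v w : V) : Digraph V :=
  ⟨fun a b => D.Adj a b ∨ (a = v ∧ b = w)⟩

/-- The digraph obtained by deleting the edge `v → w`. -/
def delEdge (D : Digraph V) (v w : V) : Digraph V :=
  ⟨fun a b => D.Adj a b ∧ ¬(a = v ∧ b = w)⟩

/-- The digraph obtained by replacing the edge `v → w` with `w → v`. -/
def revEdge (D : Digraph V) (v w : V) : Digraph V :=
  ⟨fun a b => (D.Adj a b ∧ ¬(a = v ∧ b = w)) ∨ (a = w ∧ b = v)⟩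

/-- The ordered pair `(v, w)` is partially weakly covered in `D`. -/
def PartiallyWeaklyCovered (D : Digraph V) (v w : V) : Prop :=
  maSet D {v} ⊆ maSet D {w} ∧ v ∉ an D w ∧ w ∉ an D v ∧ pa D v ≠ ∅

/-- The ordered pair `(v, w)` is implied by transitivity in `D`, i.e.
`v ∈ an_D(w) \ ({w} ∪ pa_D(w))`. -/
def ImpliedByTransitivity (D : Digraph V) (v w : V) : Prop :=
  v ∈ an D w \ ({w} ∪ pa D w)

/-- The edge `v → w` is weakly covered in `D`. -/
def WeaklyCovered (D : Digraph V) (v w : V) : Prop :=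
  maSet D (pa D v) = maSet D (pa D w \ {v}) ∧ v ∉ anSet D (pa D w \ {v})

theorem IsTrekList.tail {D : Digraph V} {a : V} {l : List V} (h : IsTrekList D (a :: l)) :
    IsTrekList D l := by
  obtain ⟨h₁, h₂, h₃⟩ := h
  refine ⟨h₁.of_cons, fun i hi => ?_, fun i hi => ?_⟩
  · simpa using h₂ (i + 1) (by simpa using hi)
  · simpa using h₃ (i + 1) (by grind)

theorem IsTrekList.adj_or_adj {D : Digraph V} {a b : V} {l : List V}
    (h : IsTrekList D (a :: b :: l)) : D.Adj a b ∨ D.Adj b a := by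
  simpa using h.2.1 0 (by simp)

theorem IsTrekList.not_collider {D : Digraph V} {a b c : V} {l : List V}
    (h : IsTrekList D (a :: b :: c :: l)) : ¬(D.Adj a b ∧ D.Adj c b) := by
  simpa using h.2.2 0 (by simp)

/-- A trek whose first edge points forward is a directed path. -/
theorem IsTrekList.head_mem_an {D : Digraph V} {w : V} {l : List V} :
    ∀ {a b : V}, IsTrekList D (a :: b :: l) → D.Adj a b →
      (a :: b :: l).getLast? = some w → a ∈ an D w := by
  induction l with
  | nil =>
    intro a b _ hab hw
    obtain rfl : b = w := by simpa using hw
    exact .single hab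
  | cons c l ih =>
    intro a b h hab hw
    have hbc : D.Adj b c :=
      h.tail.adj_or_adj.resolve_right fun hcb => h.not_collider ⟨hab, hcb⟩
    exact .head hab (ih h.tail hbc (by simpa using hw))

theorem IsTrekList.exists_common_ancestor {D : Digraph V} {w : V} {l : List V} :
    ∀ {a : V}, IsTrekList D (a :: l) → (a :: l).getLast? = some w →
      ∃ c, c ∈ an D a ∧ c ∈ an D w := by
  induction l with
  | nil =>
    intro a _ hw
    obtain rfl : a = w := by simpa using hw
    exact ⟨a, .refl, .refl⟩
  | cons b l ih =>
    intro a h hw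
    rcases h.adj_or_adj with hab | hba
    · exact ⟨a, .refl, h.head_mem_an hab hw⟩
    · obtain ⟨c, hcb, hcw⟩ := ih h.tail (by simpa using hw)
      exact ⟨c, .tail hcb hba, hcw⟩

theorem HasTrek.exists_common_ancestor {D : Digraph V} {v w : V} (h : HasTrek D v w) :
    ∃ c, c ∈ an D v ∧ c ∈ an D w := by
  obtain ⟨p, hp, hv, hw⟩ := h
  cases p with
  | nil => simp at hv
  | cons a l =>
    obtain rfl : a = v := by simpa using hv
    exact hp.exists_common_ancestor hw

theorem UAdj.exists_common_ancestor {D : Digraph V} {v w : V} (h : UAdj D v w) :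
    ∃ c, c ∈ an D v ∧ c ∈ an D w := by
  rcases h.2 with h | h
  · exact h.exists_common_ancestor
  · obtain ⟨c, hw, hv⟩ := h.exists_common_ancestor
    exact ⟨c, hv, hw⟩

theorem IsSource.eq_of_mem_an {D : Digraph V} {m c : V} (hm : IsSource D m)
    (hc : c ∈ an D m) : c = m := by
  rcases Relation.ReflTransGen.cases_tail hc with h | ⟨b, _, hbm⟩
  · exact h.symm
  · exact (Set.eq_empty_iff_forall_notMem.1 hm b hbm).elim

theorem IsDAG.an_eq_singleton_iff {D : Digraph V} (hD : IsDAG D) {m : V} :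
    an D m = {m} ↔ IsSource D m := by
  refine ⟨fun h => Set.eq_empty_iff_forall_notMem.2 fun a ha => ?_, fun h => ?_⟩
  · obtain rfl : a = m := h.subset (.single ha)
    exact hD a (.single ha)
  · exact Set.Subset.antisymm (fun _ hc => h.eq_of_mem_an hc)
      (Set.singleton_subset_iff.2 .refl)

theorem IsDAG.mem_maSet_singleton {D : Digraph V} (hD : IsDAG D) {m v : V} :
    m ∈ maSet D {v} ↔ v ∈ de D m ∧ IsSource D m := by
  simp only [maSet, anSet, hD.an_eq_singleton_iff]
  simp [an, de]

/-- For incomparable nodes with a common ancestor, failing to be partially weakly covered means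
having a source ancestor of the first node that is not an ancestor of the second. -/
theorem IsDAG.not_partiallyWeaklyCovered_iff {D : Digraph V} (hD : IsDAG D) {u v : V}
    (hc : ∃ c, c ∈ an D u ∧ c ∈ an D v) (huv : u ∉ an D v) (hvu : v ∉ an D u) :
    ¬ PartiallyWeaklyCovered D u v ↔ ∃ m, IsSource D m ∧ u ∈ de D m ∧ v ∉ de D m := by
  have hpa : pa D u ≠ ∅ := by
    intro h
    obtain ⟨c, hcu, hcv⟩ := hc
    exact huv (IsSource.eq_of_mem_an h hcu ▸ hcv)
  simp only [PartiallyWeaklyCovered, huv, hvu, hpa, not_false_eq_true, ne_eq, and_true,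
    Set.not_subset, hD.mem_maSet_singleton]
  grind

theorem impliedByTransitivity_iff {D : Digraph V} {u v : V} (huv : u ≠ v)
    (hnadj : ¬ D.Adj u v) : ImpliedByTransitivity D u v ↔ u ∈ an D v := by
  simp [ImpliedByTransitivity, pa, huv, hnadj]

/-- Let `u, v` be distinct nodes nonadjacent in the DAG `D`
but adjacent in the unconditional dependence graph `U^D`.  Then neither
`(u, v)` nor `(v, u)` is partially weakly covered or implied by transitivity
in `D` iff `u ∉ an_D(v)`, `v ∉ an_D(u)`, and there are source nodes `m'`, `m''`
with `u ∈ de_D(m')`, `v ∉ de_D(m')`, `v ∈ de_D(m'')` and `u ∉ de_D(m'')`. -/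
theorem not_addable_iff_separating_sources [Fintype V] (D : Digraph V)
    (hD : IsDAG D) (u v : V) (huv : u ≠ v) (hnadj : ¬ Adjacent D u v)
    (hUadj : UAdj D u v) :
    (¬ PartiallyWeaklyCovered D u v ∧ ¬ ImpliedByTransitivity D u v ∧
      ¬ PartiallyWeaklyCovered D v u ∧ ¬ ImpliedByTransitivity D v u) ↔
    (u ∉ an D v ∧ v ∉ an D u ∧
      ∃ m' m'' : V, IsSource D m' ∧ IsSource D m'' ∧
        u ∈ de D m' ∧ v ∉ de D m' ∧ v ∈ de D m'' ∧ u ∉ de D m'') := by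
  have hc := hUadj.exists_common_ancestor
  have hc' : ∃ c, c ∈ an D v ∧ c ∈ an D u := hc.imp fun _ h => h.symm
  rw [impliedByTransitivity_iff huv fun h => hnadj (.inl h),
    impliedByTransitivity_iff huv.symm fun h => hnadj (.inr h)]
  constructor
  · rintro ⟨hp, hu, hp', hv⟩
    obtain ⟨m', hm', h₁, h₂⟩ := (hD.not_partiallyWeaklyCovered_iff hc hu hv).1 hp
    obtain ⟨m'', hm'', h₃, h₄⟩ := (hD.not_partiallyWeaklyCovered_iff hc' hv hu).1 hp'
    exact ⟨hu, hv, m', m'', hm', hm'', h₁, h₂, h₃, h₄⟩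
  · rintro ⟨hu, hv, m', m'', hm', hm'', h₁, h₂, h₃, h₄⟩
    exact ⟨(hD.not_partiallyWeaklyCovered_iff hc hu hv).2 ⟨m', hm', h₁, h₂⟩, hu,
      (hD.not_partiallyWeaklyCovered_iff hc' hv hu).2 ⟨m'', hm'', h₃, h₄⟩, hv⟩

end UEC
end

section
/- Let G be the essential graph of a Markov equivalence class [G] of DAGs on a finite vertex set V, and let v ⊸ w be an edge of G (either directed v → w or undirected v — w). Then v ⊸ w is removable in G if and only if mt_{G−v⊸w}(v) ⊆ mt_{G−v⊸w}(w), where G−v⊸w denotes G with the edge between v and w removed. -/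
namespace UEC

variable {V : Type*}

/-- An (undirected) path in the skeleton of `D`, given as the list of its
vertices: distinct vertices, consecutive ones adjacent in either direction. -/
def IsUPath (D : Digraph V) (p : List V) : Prop :=
  p.Nodup ∧
    ∀ i : ℕ, (h : i + 1 < p.length) →
      (D.Adj (p.get ⟨i, by omega⟩) (p.get ⟨i + 1, h⟩) ∨
        D.Adj (p.get ⟨i + 1, h⟩) (p.get ⟨i, by omega⟩))

/-- A path `p` is blocked given `C` if it contains either a non-collider node
belonging to `C` or a collider node none of whose descendants belongs to `C`. -/
def BlockedGiven (D : Digraph V) (p : List V) (C : Set V) : Prop :=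
  ∃ i : ℕ, ∃ h : i + 2 < p.length,
    (D.Adj (p.get ⟨i, by omega⟩) (p.get ⟨i + 1, by omega⟩) ∧
        D.Adj (p.get ⟨i + 2, h⟩) (p.get ⟨i + 1, by omega⟩) ∧
        ∀ d ∈ de D (p.get ⟨i + 1, by omega⟩), d ∉ C) ∨
    (¬(D.Adj (p.get ⟨i, by omega⟩) (p.get ⟨i + 1, by omega⟩) ∧
        D.Adj (p.get ⟨i + 2, h⟩) (p.get ⟨i + 1, by omega⟩)) ∧
      p.get ⟨i + 1, by omega⟩ ∈ C)

/-- `A` and `B` are d-separated given `C` in `D` : every path between a node of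
`A` and a node of `B` is blocked given `C`. -/
def DSep (D : Digraph V) (A B C : Set V) : Prop :=
  ∀ a ∈ A, ∀ b ∈ B, ∀ p : List V,
    IsUPath D p → p.head? = some a → p.getLast? = some b → BlockedGiven D p C

/-- Two DAGs are Markov equivalent if they have exactly the same d-separation
statements (over pairwise disjoint sets of nodes). -/
def MarkovEquiv (D D' : Digraph V) : Prop :=
  ∀ A B C : Set V, Disjoint A B → Disjoint A C → Disjoint B C →
    (DSep D A B C ↔ DSep D' A B C)

/-- Two DAGs are unconditionally equivalent if they have exactly the same
d-separation statements with empty conditioning set. -/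
def UncondEquivSep (D D' : Digraph V) : Prop :=
  ∀ A B : Set V, Disjoint A B → (DSep D A B ∅ ↔ DSep D' A B ∅)

/-- `G` is the essential graph of the Markov equivalence class of the DAG `D`.
A partially directed graph is encoded as a `Digraph` in which an undirected
edge `a — b` is represented by having both `a → b` and `b → a`.  The essential
graph has `a → b` (in this encoding) iff some DAG Markov equivalent to `D` has
the edge `a → b`; this encodes precisely that an edge of the skeleton is
directed `a → b` iff it has this orientation in every DAG of the class, and
undirected otherwise. -/
def IsEssentialGraphOf (G : Digraph V) (D : Digraph V) : Prop :=
  IsDAG D ∧ ∀ a b : V, G.Adj a b ↔ ∃ D2 : Digraph V, IsDAG D2 ∧ MarkovEquiv D D2 ∧ D2.Adj a b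

/-- `D ∈ [G]` : `D` is a DAG in the Markov equivalence class represented by the
essential graph `G`. -/
def InMEC (G : Digraph V) (D : Digraph V) : Prop := IsEssentialGraphOf G D

/-- The preorder `v ≤ w` of a partially directed graph: `v = w` or there is a
path from `v` to `w` that is undirected or partially directed (all directed
edges pointing from `v` towards `w`).  In the both-directions encoding of
undirected edges this is exactly reflexive-transitive reachability. -/
def pdLE (G : Digraph V) (v w : V) : Prop := Relation.ReflTransGen G.Adj v w

/-- The chain component of `v` : `cc(v) = {w : v ≤ w and w ≤ v}`. -/
def cc (G : Digraph V) (v : V) : Set V := {w | pdLE G v w ∧ pdLE G w v}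

/-- The anterior of `v` : `at(v) = {w : w ≤ v}`. -/
def att (G : Digraph V) (v : V) : Set V := {w | pdLE G w v}

/-- The minimal anterior of `v` : `mt(v) = {w ∈ at(v) : at(w) = cc(w)}`. -/
def mt (G : Digraph V) (v : V) : Set V := {w | w ∈ att G v ∧ att G w = cc G w}

/-- `G − v ⊸ w` : the graph `G` with the edge between `v` and `w` removed
(in both directions, so a directed or undirected edge is removed entirely). -/
def removeBetween (G : Digraph V) (v w : V) : Digraph V :=
  ⟨fun a b => G.Adj a b ∧ ¬((a = v ∧ b = w) ∨ (a = w ∧ b = v))⟩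

/-- The edge `v ⊸ w` of the essential graph `G` is removable: there is a DAG
`D ∈ [G]` containing the edge `v → w` such that the DAG obtained from `D` by
deleting `v → w` is unconditionally equivalent to `D`. -/
def Removable (G : Digraph V) (v w : V) : Prop :=
  ∃ D : Digraph V, InMEC G D ∧ D.Adj v w ∧ UncondEquivSep D (delEdge D v w)

/-- The open neighborhood of `v` in `G` (adjacency in either direction). -/
def nbr (G : Digraph V) (v : V) : Set V :=
  {u | u ≠ v ∧ (G.Adj u v ∨ G.Adj v u)}

/-- `T = ne_G(v) ∩ ne_{G_{cc(w)}}(w)` : the neighbors of `v` in `G` that are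
also neighbors of `w` within the induced subgraph of `G` on the chain
component `cc(w)`. -/
def sideT (G : Digraph V) (v w : V) : Set V :=
  nbr G v ∩ {u | u ∈ cc G w ∧ u ≠ w ∧ (G.Adj u w ∨ G.Adj w u)}

open Relation

/-- Adjacency in the skeleton of `D`. -/
def Sk (D : Digraph V) (a b : V) : Prop := D.Adj a b ∨ D.Adj b a

theorem Sk.symm {D : Digraph V} {a b : V} (h : Sk D a b) : Sk D b a := Or.symm h

namespace IsDAG

variable {D : Digraph V}

theorem irrefl (hD : IsDAG D) {a : V} (h : D.Adj a a) : False := hD a (.single h)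

theorem asymm (hD : IsDAG D) {a b : V} (h : D.Adj a b) (h' : D.Adj b a) : False :=
  hD a (.tail (.single h) h')

theorem no_triangle (hD : IsDAG D) {a b c : V} (h : D.Adj a b) (h' : D.Adj b c)
    (h'' : D.Adj c a) : False :=
  hD a (.tail (.tail (.single h) h') h'')

theorem no_cycle (hD : IsDAG D) {a b : V} (h : D.Adj a b) (h' : ReflTransGen D.Adj b a) : False :=
  hD a (TransGen.head' h h')

theorem trans_of_sk (hD : IsDAG D) {a b c : V} (h : D.Adj a b) (h' : D.Adj b c)
    (hs : Sk D a c) : D.Adj a c :=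
  hs.resolve_right fun h'' => hD.no_triangle h h' h''

theorem exists_maximal [Finite V] (hD : IsDAG D) (S : Set V) (hS : S.Nonempty) :
    ∃ s ∈ S, ∀ t ∈ S, ¬ D.Adj s t := by
  have : IsWellFounded V (fun a b => TransGen D.Adj b a) :=
    ⟨by
      have : IsTrans V (fun a b => TransGen D.Adj b a) := ⟨fun _ _ _ h h' => h'.trans h⟩
      have : Std.Irrefl (fun a b => TransGen D.Adj b a) := ⟨fun a h => hD a h⟩
      exact Finite.wellFounded_of_trans_of_irrefl _⟩
  obtain ⟨s, hs, h⟩ := this.wf.has_min S hS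
  exact ⟨s, hs, fun t ht hst => h t ht (.single hst)⟩

theorem exists_source [Finite V] (hD : IsDAG D) (x : V) :
    ∃ s, ReflTransGen D.Adj s x ∧ ∀ t, ¬ D.Adj t s := by
  have : IsWellFounded V (TransGen D.Adj) :=
    ⟨by
      have : Std.Irrefl (TransGen D.Adj) := ⟨fun a h => hD a h⟩
      exact Finite.wellFounded_of_trans_of_irrefl _⟩
  obtain ⟨s, hs, h⟩ := this.wf.has_min {s | ReflTransGen D.Adj s x} ⟨x, .refl⟩
  exact ⟨s, hs, fun t hts => h t (.head hts hs) (.single hts)⟩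

end IsDAG

/-- `x` has a descendant in `C`. -/
def AnOf (D : Digraph V) (C : Set V) (x : V) : Prop := ∃ d, ReflTransGen D.Adj x d ∧ d ∈ C

theorem AnOf.head {D : Digraph V} {C : Set V} {x y : V} (h : D.Adj x y) (hy : AnOf D C y) :
    AnOf D C x :=
  let ⟨d, hd, hC⟩ := hy
  ⟨d, .head h hd, hC⟩

/-- The middle node of the triple `p, x, q` is open given `C`. -/
def OpenAt (D : Digraph V) (C : Set V) (p x q : V) : Prop :=
  (D.Adj p x ∧ D.Adj q x ∧ AnOf D C x) ∨ (¬ (D.Adj p x ∧ D.Adj q x) ∧ x ∉ C)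

/-- `f 0, …, f n` is a walk from `a` to `b` that is open given `C`. -/
structure OpenWalk (D : Digraph V) (C : Set V) (a b : V) (n : ℕ) (f : ℕ → V) : Prop where
  start : f 0 = a
  finish : f n = b
  sk : ∀ i, i < n → Sk D (f i) (f (i + 1))
  openAt : ∀ i, i + 1 < n → OpenAt D C (f i) (f (i + 1)) (f (i + 2))

namespace OpenWalk

variable {D D' : Digraph V} {C : Set V} {a b : V} {n : ℕ} {f : ℕ → V}

theorem snoc (h : OpenWalk D C a b n f) {c : V} (hc : Sk D b c)
    (ho : ∀ m, n = m + 1 → OpenAt D C (f m) b c) :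
    OpenWalk D C a c (n + 1) (fun i => if i ≤ n then f i else c) where
  start := by simpa using h.start
  finish := if_neg (by omega)
  sk i hi := by
    rcases eq_or_lt_of_le (show i ≤ n by omega) with rfl | hlt
    · rw [if_pos le_rfl, if_neg (by omega), h.finish]
      exact hc
    · rw [if_pos hlt.le, if_pos (by omega)]
      exact h.sk i hlt
  openAt i hi := by
    rcases eq_or_lt_of_le (show i + 1 ≤ n by omega) with rfl | hlt
    · rw [if_pos (by omega), if_pos le_rfl, if_neg (by omega), h.finish]
      exact ho i rfl
    · rw [if_pos (by omega), if_pos (by omega), if_pos (by omega)]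
      exact h.openAt i hlt

/-- Removing the `k` nodes following position `i`. -/
theorem cut (h : OpenWalk D C a b n f) (i k : ℕ) (hik : i + k + 1 ≤ n)
    (hsk : Sk D (f i) (f (i + k + 1)))
    (hl : ∀ i', i = i' + 1 → OpenAt D C (f i') (f i) (f (i + k + 1)))
    (hr : i + k + 2 ≤ n → OpenAt D C (f i) (f (i + k + 1)) (f (i + k + 2))) :
    ∃ g, OpenWalk D C a b (n - k) g := by
  refine ⟨fun t => if t ≤ i then f t else f (t + k), ?_, ?_, ?_, ?_⟩
  · simpa using h.start
  · rw [if_neg (by omega), Nat.sub_add_cancel (by omega), h.finish]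
  · intro t ht
    rcases lt_trichotomy t i with hti | hti | hti
    · rw [if_pos (by omega), if_pos (by omega)]
      exact h.sk t (by omega)
    · subst hti
      rw [if_pos (by omega), if_neg (by omega)]
      rwa [show t + 1 + k = t + k + 1 by omega]
    · rw [if_neg (by omega), if_neg (by omega), show t + 1 + k = t + k + 1 by omega]
      exact h.sk _ (by omega)
  · intro t ht
    rcases lt_trichotomy (t + 1) i with hti | hti | hti
    · rw [if_pos (by omega), if_pos (by omega), if_pos (by omega)]
      exact h.openAt t (by omega)
    · subst hti
      rw [if_pos (by omega), if_pos (by omega), if_neg (by omega)]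
      have := hl t rfl
      rwa [show t + 2 + k = t + 1 + k + 1 by omega]
    · rcases eq_or_lt_of_le (show i ≤ t by omega) with hti' | hti'
      · subst hti'
        rw [if_pos (by omega), if_neg (by omega), if_neg (by omega)]
        have := hr (by omega)
        rwa [show i + 1 + k = i + k + 1 by omega, show i + 2 + k = i + k + 2 by omega]
      · rw [if_neg (by omega), if_neg (by omega), if_neg (by omega),
          show t + 1 + k = t + k + 1 by omega, show t + 2 + k = t + k + 2 by omega]
        exact h.openAt _ (by omega)

/-- An open walk leaving a node through an outgoing edge continues as a directed path unless it
meets a collider below that node. -/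
theorem forward (h : OpenWalk D C a b n f) {i : ℕ} (hi : D.Adj (f i) (f (i + 1)))
    (j : ℕ) (hj : i + j + 1 ≤ n) :
    AnOf D C (f i) ∨ ReflTransGen D.Adj (f i) (f (i + j + 1)) ∧
      D.Adj (f (i + j)) (f (i + j + 1)) := by
  induction j with
  | zero => exact .inr ⟨.single hi, hi⟩
  | succ j ih =>
    rcases ih (by omega) with h1 | ⟨h1, h2⟩
    · exact .inl h1
    · rcases h.openAt (i + j) (by omega) with ⟨-, -, d, hd, hC⟩ | ⟨h3, -⟩
      · exact .inl ⟨d, h1.trans hd, hC⟩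
      · have h4 : D.Adj (f (i + j + 1)) (f (i + j + 2)) :=
          (h.sk (i + j + 1) (by omega)).resolve_right fun h5 => h3 ⟨h2, h5⟩
        exact .inr ⟨h1.tail h4, h4⟩

/-- A loop of an open walk can be cut out. -/
theorem cut_loop (h : OpenWalk D C a b n f) {i j : ℕ} (hij : i < j) (hj : j ≤ n)
    (heq : f i = f j) : ∃ m < n, ∃ g, OpenWalk D C a b m g := by
  rcases eq_or_lt_of_le hj with rfl | hj
  · exact ⟨i, hij, f, h.start, heq.trans h.finish, fun t ht => h.sk t (by omega),
      fun t ht => h.openAt t (by omega)⟩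
  obtain ⟨k, rfl⟩ : ∃ k, j = i + k + 1 := ⟨j - i - 1, by omega⟩
  refine ⟨n - (k + 1), by omega, h.cut i (k + 1) (by omega) ?_ ?_ ?_⟩
  · rw [heq]; exact h.sk _ hj
  · rintro i rfl
    have h1 := h.openAt i (by omega)
    have h2 := h.openAt (i + 1 + k) (by omega)
    rw [← heq] at h2
    by_cases hc : D.Adj (f i) (f (i + 1)) ∧ D.Adj (f (i + 1 + (k + 1) + 1)) (f (i + 1))
    · refine .inl ⟨hc.1, hc.2, ?_⟩
      rcases h1 with ⟨-, -, h1⟩ | ⟨h1, -⟩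
      · exact h1
      rcases h2 with ⟨-, -, h2⟩ | ⟨h2, -⟩
      · exact h2
      have h3 := (h.sk (i + 1) (by omega)).resolve_right fun h3 => h1 ⟨hc.1, h3⟩
      rcases h.forward h3 k (by omega) with h4 | ⟨-, h4⟩
      · exact h4
      · rw [← heq] at h4
        exact absurd ⟨h4, hc.2⟩ h2
    · refine .inr ⟨hc, ?_⟩
      rcases h1 with ⟨h1, -, -⟩ | ⟨-, h1⟩
      · rcases h2 with ⟨-, h2, -⟩ | ⟨-, h2⟩
        · exact absurd ⟨h1, h2⟩ hc
        · exact h2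
      · exact h1
  · intro hn
    rw [heq]
    exact h.openAt _ (by omega)

end OpenWalk

/-- An open walk of minimal length. -/
structure ShortestWalk (D : Digraph V) (C : Set V) (a b : V) (n : ℕ) (f : ℕ → V) : Prop
    extends OpenWalk D C a b n f where
  min : ∀ m < n, ∀ g, ¬ OpenWalk D C a b m g

namespace ShortestWalk

variable {D D' : Digraph V} {C : Set V} {a b : V} {n : ℕ} {f : ℕ → V}

theorem cut_false (h : ShortestWalk D C a b n f) (i k : ℕ) (hk : 0 < k) (hik : i + k + 1 ≤ n)
    (hsk : Sk D (f i) (f (i + k + 1)))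
    (hl : ∀ i', i = i' + 1 → OpenAt D C (f i') (f i) (f (i + k + 1)))
    (hr : i + k + 2 ≤ n → OpenAt D C (f i) (f (i + k + 1)) (f (i + k + 2))) : False :=
  let ⟨g, hg⟩ := h.toOpenWalk.cut i k hik hsk hl hr
  h.min _ (by omega) g hg

theorem injOn (h : ShortestWalk D C a b n f) {i j : ℕ} (hij : i < j)
    (hj : j ≤ n) : f i ≠ f j := fun heq =>
  let ⟨m, hm, g, hg⟩ := h.toOpenWalk.cut_loop hij hj heq
  h.min m hm g hg

theorem not_mem_of_out_right (hD : IsDAG D) (h : OpenWalk D C a b n f) {i : ℕ} (hi : i + 1 < n)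
    (ho : D.Adj (f (i + 1)) (f (i + 2))) : f (i + 1) ∉ C := by
  rcases h.openAt i hi with ⟨-, h1, -⟩ | ⟨-, h1⟩
  · exact (hD.asymm ho h1).elim
  · exact h1

theorem not_mem_of_out_left (hD : IsDAG D) (h : OpenWalk D C a b n f) {i : ℕ} (hi : i + 1 < n)
    (ho : D.Adj (f (i + 1)) (f i)) : f (i + 1) ∉ C := by
  rcases h.openAt i hi with ⟨h1, -, -⟩ | ⟨-, h1⟩
  · exact (hD.asymm ho h1).elim
  · exact h1

theorem openAt_congr_left {p p' x q : V} (h : OpenAt D C p x q) (hp : D.Adj p x)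
    (hp' : D.Adj p' x) : OpenAt D C p' x q := by
  simp only [OpenAt, hp, hp', true_and] at h ⊢
  exact h

theorem openAt_congr_right {p q q' x : V} (h : OpenAt D C p x q) (hq : D.Adj q x)
    (hq' : D.Adj q' x) : OpenAt D C p x q' := by
  simp only [OpenAt, hq, hq', and_true, true_and] at h ⊢
  exact h

theorem openAt_of_out_right (hD : IsDAG D) {p q x : V} (hx : x ∉ C) (h : D.Adj x q) :
    OpenAt D C p x q := .inr ⟨fun h' => hD.asymm h h'.2, hx⟩

theorem openAt_of_out_left (hD : IsDAG D) {p q x : V} (hx : x ∉ C) (h : D.Adj x p) :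
    OpenAt D C p x q := .inr ⟨fun h' => hD.asymm h h'.1, hx⟩

theorem openAt_of_an {p q x : V} (hx : x ∉ C) (h : AnOf D C x) : OpenAt D C p x q := by
  by_cases hc : D.Adj p x ∧ D.Adj q x
  · exact .inl ⟨hc.1, hc.2, h⟩
  · exact .inr ⟨hc, hx⟩

/-- Colliders on a shortest open walk are unshielded. -/
theorem collider_unshielded (hD : IsDAG D) (h : ShortestWalk D C a b n f) {i : ℕ}
    (hi : i + 1 < n) (h1 : D.Adj (f i) (f (i + 1))) (h2 : D.Adj (f (i + 2)) (f (i + 1))) :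
    ¬ Sk D (f i) (f (i + 2)) := by
  intro hs
  have hy : AnOf D C (f (i + 1)) := by
    rcases h.openAt i hi with ⟨-, -, h3⟩ | ⟨h3, -⟩
    · exact h3
    · exact absurd ⟨h1, h2⟩ h3
  refine h.cut_false i 1 one_pos hi hs ?_ ?_
  · rintro i rfl
    exact openAt_of_an (not_mem_of_out_right hD h.toOpenWalk (by omega) h1) (hy.head h1)
  · intro hn
    exact openAt_of_an (not_mem_of_out_left hD h.toOpenWalk (i := i + 1) (by omega) h2)
      (hy.head h2)

theorem not_chain_right (hD : IsDAG D) (h : ShortestWalk D C a b n f) {i : ℕ}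
    (hi : i + 1 < n) (h1 : D.Adj (f i) (f (i + 1))) (h2 : D.Adj (f (i + 1)) (f (i + 2))) :
    ¬ Sk D (f i) (f (i + 2)) := by
  intro hs
  have h3 := hD.trans_of_sk h1 h2 hs
  refine h.cut_false i 1 one_pos hi hs ?_ ?_
  · rintro i rfl
    exact openAt_of_out_right hD (not_mem_of_out_right hD h.toOpenWalk (by omega) h1) h3
  · intro hn
    exact openAt_congr_left (h.openAt (i + 1) (by omega)) h2 h3

theorem not_chain_left (hD : IsDAG D) (h : ShortestWalk D C a b n f) {i : ℕ}
    (hi : i + 1 < n) (h1 : D.Adj (f (i + 1)) (f i)) (h2 : D.Adj (f (i + 2)) (f (i + 1))) :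
    ¬ Sk D (f i) (f (i + 2)) := by
  intro hs
  have h3 := hD.trans_of_sk h2 h1 hs.symm
  refine h.cut_false i 1 one_pos hi hs ?_ ?_
  · rintro i rfl
    exact openAt_congr_right (h.openAt i (by omega)) h1 h3
  · intro hn
    exact openAt_of_out_left hD
      (not_mem_of_out_left hD h.toOpenWalk (i := i + 1) (by omega) h2) h3

theorem fork_right (hD : IsDAG D) (h : ShortestWalk D C a b n f) {i : ℕ}
    (hi : i + 1 < n) (h1 : D.Adj (f (i + 1)) (f i)) (h2 : D.Adj (f (i + 1)) (f (i + 2)))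
    (h3 : D.Adj (f i) (f (i + 2))) :
    ∃ j, i = j + 1 ∧ D.Adj (f j) (f i) ∧ ¬ Sk D (f j) (f (i + 2)) := by
  by_contra hcon
  push Not at hcon
  refine h.cut_false i 1 one_pos hi (.inl h3) ?_ ?_
  · rintro j rfl
    refine openAt_of_out_right hD ?_ h3
    intro hC
    have hp : D.Adj (f j) (f (j + 1)) := by
      rcases h.openAt j (by omega) with h4 | h4
      · exact h4.1
      · exact absurd hC h4.2
    have hs := hcon j rfl hp
    have hz := hD.trans_of_sk hp h3 hs
    refine h.cut_false j 2 two_pos (by omega) hs ?_ ?_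
    · rintro j rfl
      exact openAt_of_out_right hD (not_mem_of_out_right hD h.toOpenWalk (by omega) hp) hz
    · intro hn
      exact openAt_congr_left (h.openAt (j + 2) (by omega)) h2 hz
  · intro hn
    exact openAt_congr_left (h.openAt (i + 1) (by omega)) h2 h3

theorem fork_left (hD : IsDAG D) (h : ShortestWalk D C a b n f) {i : ℕ}
    (hi : i + 1 < n) (h1 : D.Adj (f (i + 1)) (f i)) (h2 : D.Adj (f (i + 1)) (f (i + 2)))
    (h3 : D.Adj (f (i + 2)) (f i)) :
    i + 2 < n ∧ D.Adj (f (i + 3)) (f (i + 2)) ∧ ¬ Sk D (f i) (f (i + 3)) := by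
  by_contra hcon
  push Not at hcon
  refine h.cut_false i 1 one_pos hi (.inr h3) ?_ ?_
  · rintro j rfl
    exact openAt_congr_right (h.openAt j (by omega)) h1 h3
  · intro hn
    refine openAt_of_out_left hD ?_ h3
    intro hC
    have hp : D.Adj (f (i + 3)) (f (i + 2)) := by
      rcases h.openAt (i + 1) (by omega) with h4 | h4
      · exact h4.2.1
      · exact absurd hC h4.2
    have hs := hcon (by omega) hp
    have hz := hD.trans_of_sk hp h3 hs.symm
    refine h.cut_false i 2 two_pos (by omega) hs ?_ ?_
    · rintro j rfl
      exact openAt_congr_right (h.openAt j (by omega)) h1 hz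
    · intro hn
      exact openAt_of_out_left hD
        (not_mem_of_out_left hD h.toOpenWalk (i := i + 2) (by omega) hp) hz

end ShortestWalk
/-- Same skeleton and same unshielded colliders. -/
structure SameSkelColl (D D' : Digraph V) : Prop where
  sk : ∀ a b, Sk D a b ↔ Sk D' a b
  coll : ∀ a b c, a ≠ c → ¬ Sk D a c → (D.Adj a b ∧ D.Adj c b ↔ D'.Adj a b ∧ D'.Adj c b)

theorem SameSkelColl.symm {D D' : Digraph V} (h : SameSkelColl D D') : SameSkelColl D' D :=
  ⟨fun a b => (h.sk a b).symm, fun a b c hac hs =>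
    (h.coll a b c hac fun h' => hs ((h.sk a c).1 h')).symm⟩

/-- Orientation propagates along an unshielded chain. -/
theorem SameSkelColl.adj_of_unshielded {D D' : Digraph V} (hV : SameSkelColl D D')
    (hD : IsDAG D) {a b c : V} (h' : D'.Adj a b) (h2 : D.Adj b c)
    (hs : ¬ Sk D a c) (hac : a ≠ c) : D'.Adj b c := by
  refine ((hV.sk b c).1 (.inl h2)).resolve_right fun h3 => ?_
  exact hD.asymm h2 ((hV.coll a b c hac hs).2 ⟨h', h3⟩).2

/-- `x` reaches `C` by a directed walk of length `k`. -/
def ReachIn (D : Digraph V) (C : Set V) : ℕ → V → Prop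
  | 0, x => x ∈ C
  | k + 1, x => ∃ y, D.Adj x y ∧ ReachIn D C k y

/-- The length of a shortest directed walk from `x` to `C`. -/
noncomputable def distTo (D : Digraph V) (C : Set V) (x : V) : ℕ := sInf {k | ReachIn D C k x}

section distTo

variable {D D' : Digraph V} {C : Set V}

theorem AnOf.exists_reachIn {x : V} (h : AnOf D C x) : ∃ k, ReachIn D C k x := by
  obtain ⟨d, hd, hC⟩ := h
  induction hd using ReflTransGen.head_induction_on with
  | refl => exact ⟨0, hC⟩
  | head h1 _ ih =>
    obtain ⟨k, hk⟩ := ih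
    exact ⟨k + 1, _, h1, hk⟩

theorem ReachIn.anOf {k : ℕ} : ∀ {x : V}, ReachIn D C k x → AnOf D C x := by
  induction k with
  | zero => exact fun h => ⟨_, .refl, h⟩
  | succ k ih =>
    rintro x ⟨y, hxy, hy⟩
    exact (ih hy).head hxy

theorem AnOf.reachIn_distTo {x : V} (h : AnOf D C x) : ReachIn D C (distTo D C x) x :=
  Nat.sInf_mem h.exists_reachIn

theorem AnOf.mem_or_exists {x : V} (h : AnOf D C x) :
    x ∈ C ∨ ∃ y, D.Adj x y ∧ AnOf D C y ∧ distTo D C x = distTo D C y + 1 := by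
  have h1 := h.reachIn_distTo
  cases hk : distTo D C x with
  | zero =>
    rw [hk] at h1
    exact .inl h1
  | succ k =>
    rw [hk] at h1
    obtain ⟨y, hxy, hy⟩ := h1
    refine .inr ⟨y, hxy, hy.anOf, ?_⟩
    have h2 : distTo D C y ≤ k := Nat.sInf_le hy
    have h3 : distTo D C x ≤ distTo D C y + 1 :=
      Nat.sInf_le ⟨y, hxy, hy.anOf.reachIn_distTo⟩
    omega

theorem anOf_of_unshielded (hV : SameSkelColl D D') (hD : IsDAG D) (k : ℕ) :
    ∀ {u x y : V}, D.Adj u x → D'.Adj u x → D.Adj x y → ¬ Sk D u y → AnOf D C y →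
      distTo D C x = distTo D C y + 1 → distTo D C y = k → AnOf D' C x := by
  induction k with
  | zero =>
    intro u x y h1 h2 h3 h4 h5 _ h7
    have h8 := h5.reachIn_distTo
    rw [h7] at h8
    have hne : u ≠ y := by rintro rfl; exact hD.asymm h1 h3
    exact ⟨y, .single (hV.adj_of_unshielded hD h2 h3 h4 hne), h8⟩
  | succ k ih =>
    intro u x y h1 h2 h3 h4 h5 h6 h7
    have hne : u ≠ y := by rintro rfl; exact hD.asymm h1 h3
    have h8 := hV.adj_of_unshielded hD h2 h3 h4 hne
    have h9 := h5.reachIn_distTo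
    rw [h7] at h9
    rcases h5.mem_or_exists with hC | ⟨z, hyz, hz, hd⟩
    · exact ⟨y, .single h8, hC⟩
    · refine (ih h3 h8 hyz ?_ hz hd (by omega)).head h8
      intro hs
      have h10 := hD.trans_of_sk h3 hyz hs
      have h11 : distTo D C x ≤ distTo D C z + 1 := Nat.sInf_le ⟨z, h10, hz.reachIn_distTo⟩
      omega

end distTo

theorem OpenWalk.exists_minimal {D : Digraph V} {C : Set V} {a b : V} (d : V → ℕ)
    (h : ∃ n f, OpenWalk D C a b n f) :
    ∃ n f, ShortestWalk D C a b n f ∧ ∀ g, OpenWalk D C a b n g →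
      ∑ i ∈ Finset.range n, d (f i) ≤ ∑ i ∈ Finset.range n, d (g i) := by
  classical
  have h2 : ∃ s f, OpenWalk D C a b (Nat.find h) f ∧
      s = ∑ i ∈ Finset.range (Nat.find h), d (f i) :=
    let ⟨f, hf⟩ := Nat.find_spec h
    ⟨_, f, hf, rfl⟩
  obtain ⟨f, hf, hs⟩ := Nat.find_spec h2
  refine ⟨Nat.find h, f, ⟨hf, fun m hm g hg => Nat.find_min h hm ⟨g, hg⟩⟩, fun g hg => ?_⟩
  rw [← hs]
  exact Nat.find_min' h2 ⟨g, hg, rfl⟩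

theorem OpenWalk.transfer {D D' : Digraph V} (hD : IsDAG D) (hD' : IsDAG D')
    (hV : SameSkelColl D D') {C : Set V} {a b : V} (h : ∃ n f, OpenWalk D C a b n f) :
    ∃ n f, OpenWalk D' C a b n f := by
  obtain ⟨n, f, h, hmin⟩ := OpenWalk.exists_minimal (distTo D C) h
  refine ⟨n, f, h.start, h.finish, fun i hi => (hV.sk _ _).1 (h.sk i hi), fun i hi => ?_⟩
  have hne : f i ≠ f (i + 2) := h.injOn (by omega) (by omega)
  rcases h.openAt i hi with ⟨h1, h2, h3⟩ | ⟨h1, h2⟩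
  · have hs := h.collider_unshielded hD hi h1 h2
    obtain ⟨h1', h2'⟩ := (hV.coll _ _ _ hne hs).1 ⟨h1, h2⟩
    refine .inl ⟨h1', h2', ?_⟩
    rcases h3.mem_or_exists with hC | ⟨d, hyd, hd, hdist⟩
    · exact ⟨_, .refl, hC⟩
    by_cases hl : Sk D (f i) d
    · by_cases hr : Sk D (f (i + 2)) d
      · exfalso
        have hl := hD.trans_of_sk h1 hyd hl
        have hr := hD.trans_of_sk h2 hyd hr
        have hx : ∀ j, i = j + 1 → f i ∉ C := by
          rintro j rfl
          exact ShortestWalk.not_mem_of_out_right hD h.toOpenWalk (by omega) h1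
        have hz : i + 2 < n → f (i + 2) ∉ C := fun hn =>
          ShortestWalk.not_mem_of_out_left hD h.toOpenWalk (i := i + 1) (by omega) h2
        have hw : OpenWalk D C a b n (Function.update f (i + 1) d) := by
          refine ⟨?_, ?_, fun t ht => ?_, fun t ht => ?_⟩
          · rw [Function.update_of_ne (by omega), h.start]
          · rw [Function.update_of_ne (by omega), h.finish]
          · by_cases ht1 : t = i
            · subst ht1
              rw [Function.update_of_ne (by omega), Function.update_self]
              exact .inl hl
            by_cases ht2 : t = i + 1
            · subst ht2
              rw [Function.update_self, Function.update_of_ne (by omega)]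
              exact .inr hr
            rw [Function.update_of_ne (by omega), Function.update_of_ne (by omega)]
            exact h.sk t ht
          · by_cases ht1 : t + 1 = i
            · subst ht1
              rw [Function.update_of_ne (by omega), Function.update_of_ne (by omega),
                Function.update_self]
              exact ShortestWalk.openAt_of_out_right hD (hx t rfl) hl
            by_cases ht2 : t = i
            · subst ht2
              rw [Function.update_of_ne (by omega), Function.update_self,
                Function.update_of_ne (by omega)]
              exact .inl ⟨hl, hr, hd⟩
            by_cases ht3 : t = i + 1
            · subst ht3
              rw [Function.update_self, Function.update_of_ne (by omega),
                Function.update_of_ne (by omega)]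
              exact ShortestWalk.openAt_of_out_left hD (hz (by omega)) hr
            rw [Function.update_of_ne (by omega), Function.update_of_ne (by omega),
              Function.update_of_ne (by omega)]
            exact h.openAt t ht
        refine (hmin _ hw).not_gt (Finset.sum_lt_sum (fun j _ => ?_) ⟨i + 1, ?_, ?_⟩)
        · by_cases hj : j = i + 1
          · subst hj
            rw [Function.update_self]
            omega
          · rw [Function.update_of_ne hj]
        · simpa using hi
        · rw [Function.update_self]
          omega
      · exact anOf_of_unshielded hV hD _ h2 h2' hyd hr hd hdist rfl
    · exact anOf_of_unshielded hV hD _ h1 h1' hyd hl hd hdist rfl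
  · refine .inr ⟨?_, h2⟩
    by_cases hs : Sk D (f i) (f (i + 2))
    · have hxy := h.sk i (by omega)
      have hyz := h.sk (i + 1) hi
      have hyx : D.Adj (f (i + 1)) (f i) := by
        refine hxy.resolve_left fun h3 => ?_
        exact h.not_chain_right hD hi h3 (hyz.resolve_right fun h4 => h1 ⟨h3, h4⟩) hs
      have hyz : D.Adj (f (i + 1)) (f (i + 2)) :=
        hyz.resolve_right fun h4 => h.not_chain_left hD hi hyx h4 hs
      rintro ⟨h3, h4⟩
      rcases hs with hs | hs
      · obtain ⟨j, rfl, h5, h6⟩ := h.fork_right hD hi hyx hyz hs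
        have h7 := h.collider_unshielded hD (by omega) h5 hyx
        have h8 := (hV.coll _ _ _ (h.injOn (by omega) (by omega)) h7).1 ⟨h5, hyx⟩
        exact hD'.asymm h8.2 h3
      · obtain ⟨hn, h5, h6⟩ := h.fork_left hD hi hyx hyz hs
        have h7 := h.collider_unshielded (i := i + 1) hD (by omega) hyz h5
        have h8 := (hV.coll _ _ _ (h.injOn (by omega) (by omega)) h7).1 ⟨hyz, h5⟩
        exact hD'.asymm h8.1 h4
    · exact fun h3 => h1 ((hV.coll _ _ _ hne hs).2 h3)

theorem dSep_iff (D : Digraph V) (A B C : Set V) :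
    DSep D A B C ↔ ∀ a ∈ A, ∀ b ∈ B, ¬ ∃ n f, OpenWalk D C a b n f := by
  refine forall₂_congr fun a _ => forall₂_congr fun b _ => ⟨fun h hw => ?_, fun h p hp ha hb => ?_⟩
  · obtain ⟨n, f, hf, -⟩ := OpenWalk.exists_minimal (fun _ => 0) hw
    have hinj : ∀ i j, i ≤ n → j ≤ n → f i = f j → i = j := fun i j hi hj hij => by
      rcases lt_trichotomy i j with h1 | h1 | h1
      · exact absurd hij (hf.injOn h1 hj)
      · exact h1
      · exact absurd hij.symm (hf.injOn h1 hi)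
    obtain ⟨i, hi, hb⟩ := h ((List.range (n + 1)).map f)
      ⟨List.Nodup.map_on (fun x hx y hy => hinj x y (by simp at hx; omega) (by simp at hy; omega))
        List.nodup_range, fun i hi => by
          simpa [Sk] using hf.sk i (by simpa using hi)⟩
      (by rw [List.head?_map, List.head?_range]; simp [hf.start])
      (by simp [List.getLast?_map, List.getLast?_range, hf.finish])
    have hi' : i + 1 < n := by
      simp at hi
      omega
    simp only [List.get_eq_getElem, List.getElem_map, List.getElem_range] at hb
    rcases hb with ⟨h1, h2, h3⟩ | ⟨h1, h2⟩
    · rcases hf.openAt i hi' with ⟨-, -, d, hd, hC⟩ | ⟨h4, -⟩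
      · exact h3 d hd hC
      · exact h4 ⟨h1, h2⟩
    · rcases hf.openAt i hi' with ⟨h3, h4, -⟩ | ⟨-, h3⟩
      · exact h1 ⟨h3, h4⟩
      · exact h3 h2
  · by_contra hcon
    have hpos : p.length ≠ 0 := by
      intro h0
      simp [List.length_eq_zero_iff.1 h0] at ha
    have hget : ∀ i (hi : i < p.length), p.getD i a = p.get ⟨i, hi⟩ := fun i hi => by simp [hi]
    refine h ⟨p.length - 1, fun i => p.getD i a, ?_, ?_, fun i hi => ?_, fun i hi => ?_⟩
    · rw [List.head?_eq_getElem?] at ha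
      simp [ha]
    · rw [List.getLast?_eq_getElem?] at hb
      simp [List.getD_eq_getElem?_getD, hb]
    · have := hp.2 i (by omega)
      rwa [hget _ (by omega), hget _ (by omega)]
    · rw [hget _ (by omega), hget _ (by omega), hget _ (by omega)]
      by_contra h1
      refine hcon ⟨i, by omega, ?_⟩
      simp only [OpenAt, AnOf, not_or, not_and, not_exists, not_not] at h1
      by_cases h2 : D.Adj (p.get ⟨i, by omega⟩) (p.get ⟨i + 1, by omega⟩) ∧
        D.Adj (p.get ⟨i + 2, by omega⟩) (p.get ⟨i + 1, by omega⟩)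
      · exact .inl ⟨h2.1, h2.2, h1.1 h2.1 h2.2⟩
      · exact .inr ⟨h2, h1.2 fun h3 h4 => h2 ⟨h3, h4⟩⟩

theorem SameSkelColl.markovEquiv {D D' : Digraph V} (hD : IsDAG D) (hD' : IsDAG D')
    (hV : SameSkelColl D D') : MarkovEquiv D D' := by
  intro A B C _ _ _
  rw [dSep_iff, dSep_iff]
  refine forall₂_congr fun a _ => forall₂_congr fun b _ => not_congr ?_
  exact ⟨OpenWalk.transfer hD hD' hV, OpenWalk.transfer hD' hD hV.symm⟩

/-- Nonadjacent nodes are separated by the parents of one that is not an ancestor of the other. -/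
theorem dSep_parents {D : Digraph V} (hD : IsDAG D) {x y : V} (hne : x ≠ y) (hs : ¬ Sk D x y)
    (hxy : ¬ ReflTransGen D.Adj x y) : DSep D {x} {y} {z | D.Adj z x} := by
  rw [dSep_iff]
  rintro _ rfl _ rfl ⟨n, f, hf⟩
  obtain ⟨m, rfl⟩ : ∃ m, n = m + 2 := by
    match n, hf with
    | 0, hf => exact absurd (hf.start.symm.trans hf.finish) hne
    | 1, hf =>
      have := hf.sk 0 one_pos
      rw [hf.start, hf.finish] at this
      exact absurd this hs
    | m + 2, _ => exact ⟨m, rfl⟩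
  have hout : D.Adj (f 0) (f 1) := by
    refine (hf.sk 0 (by omega)).resolve_right fun h1 => ?_
    rcases hf.openAt 0 (by omega) with ⟨h2, -⟩ | ⟨-, h2⟩
    · exact hD.asymm h1 h2
    · rw [hf.start] at h1
      exact h2 h1
  rcases hf.forward hout (m + 1) (by omega) with ⟨d, hd, hC⟩ | ⟨h1, -⟩
  · rw [hf.start] at hd
    exact hD.no_cycle hC hd
  · rw [hf.start, zero_add, hf.finish] at h1
    exact hxy h1

theorem MarkovEquiv.symm {D D' : Digraph V} (h : MarkovEquiv D D') : MarkovEquiv D' D :=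
  fun A B C h1 h2 h3 => (h A B C h1 h2 h3).symm

theorem MarkovEquiv.trans {D D' D'' : Digraph V} (h : MarkovEquiv D D') (h' : MarkovEquiv D' D'') :
    MarkovEquiv D D'' :=
  fun A B C h1 h2 h3 => (h A B C h1 h2 h3).trans (h' A B C h1 h2 h3)

/-- Nonadjacent nodes `x`, `y` are separated by the parents of `x` or by those of `y`. -/
theorem exists_dSep {D : Digraph V} (hD : IsDAG D) {x y : V} (hne : x ≠ y) (hs : ¬ Sk D x y) :
    ∃ x' y', (x' = x ∧ y' = y ∨ x' = y ∧ y' = x) ∧ Disjoint ({x'} : Set V) {z | D.Adj z x'} ∧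
      Disjoint ({y'} : Set V) {z | D.Adj z x'} ∧ DSep D {x'} {y'} {z | D.Adj z x'} := by
  have key : ∀ x y, x ≠ y → ¬ Sk D x y → ¬ ReflTransGen D.Adj x y →
      Disjoint ({x} : Set V) {z | D.Adj z x} ∧
      Disjoint ({y} : Set V) {z | D.Adj z x} ∧ DSep D {x} {y} {z | D.Adj z x} :=
    fun x y hne hs h => ⟨Set.disjoint_singleton_left.2 hD.irrefl,
      Set.disjoint_singleton_left.2 fun h' => hs (.inr h'), dSep_parents hD hne hs h⟩
  by_cases h : ReflTransGen D.Adj x y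
  · refine ⟨y, x, .inr ⟨rfl, rfl⟩, key y x hne.symm (fun h => hs h.symm) fun h' => ?_⟩
    rcases h.cases_head with h | ⟨z, hz, h⟩
    · exact hne h
    · exact hD.no_cycle hz (h.trans h')
  · exact ⟨x, y, .inl ⟨rfl, rfl⟩, key x y hne hs h⟩

theorem MarkovEquiv.sk_imp {D D' : Digraph V} (hD : IsDAG D) (hD' : IsDAG D')
    (h : MarkovEquiv D D') {x y : V} (hs : Sk D x y) : Sk D' x y := by
  by_contra hs'
  have hne : x ≠ y := by
    rintro rfl
    rcases hs with h | h <;> exact hD.irrefl h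
  obtain ⟨x', y', hxy, h1, h2, h3⟩ := exists_dSep hD' hne hs'
  have hne' : x' ≠ y' := by rcases hxy with ⟨rfl, rfl⟩ | ⟨rfl, rfl⟩ <;> [exact hne; exact hne.symm]
  have hsk : Sk D x' y' := by
    rcases hxy with ⟨rfl, rfl⟩ | ⟨rfl, rfl⟩ <;> [exact hs; exact hs.symm]
  rw [← h _ _ _ (by simpa using hne') h1 h2, dSep_iff] at h3
  refine h3 x' rfl y' rfl ⟨1, fun i => if i = 0 then x' else y', rfl, rfl, fun i hi => ?_,
    fun i hi => by omega⟩
  obtain rfl : i = 0 := by omega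
  exact hsk

theorem MarkovEquiv.coll_imp {D D' : Digraph V} (hD : IsDAG D) (hD' : IsDAG D')
    (h : MarkovEquiv D D') {a b c : V} (hne : a ≠ c) (hs : ¬ Sk D a c) (hab : D.Adj a b)
    (hcb : D.Adj c b) : D'.Adj a b ∧ D'.Adj c b := by
  by_contra hcon
  obtain ⟨x, y, hxy, h1, h2, h3⟩ := exists_dSep hD hne hs
  have hne' : x ≠ y := by rcases hxy with ⟨rfl, rfl⟩ | ⟨rfl, rfl⟩ <;> [exact hne; exact hne.symm]
  have hx : D.Adj x b ∧ D.Adj y b ∧ ¬ (D'.Adj x b ∧ D'.Adj y b) := by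
    rcases hxy with ⟨rfl, rfl⟩ | ⟨rfl, rfl⟩
    · exact ⟨hab, hcb, hcon⟩
    · exact ⟨hcb, hab, fun h' => hcon h'.symm⟩
  rw [h _ _ _ (by simpa using hne') h1 h2, dSep_iff] at h3
  refine h3 x rfl y rfl ⟨2, fun i => if i = 0 then x else if i = 1 then b else y, rfl, rfl,
    fun i hi => ?_, fun i hi => ?_⟩
  · obtain rfl | rfl : i = 0 ∨ i = 1 := by omega
    · exact h.sk_imp hD hD' (.inl hx.1)
    · exact h.sk_imp hD hD' (.inr hx.2.1)
  · obtain rfl : i = 0 := by omega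
    exact .inr ⟨hx.2.2, fun h4 => hD.asymm hx.1 h4⟩

theorem MarkovEquiv.sameSkelColl {D D' : Digraph V} (hD : IsDAG D) (hD' : IsDAG D')
    (h : MarkovEquiv D D') : SameSkelColl D D' :=
  ⟨fun _ _ => ⟨h.sk_imp hD hD', h.symm.sk_imp hD' hD⟩, fun _ _ _ hne hs =>
    ⟨fun h1 => h.coll_imp hD hD' hne hs h1.1 h1.2, fun h1 =>
      h.symm.coll_imp hD' hD hne (fun h2 => hs (h.symm.sk_imp hD' hD h2)) h1.1 h1.2⟩⟩

/-- The edges of `D` whose orientation is forced by unshielded colliders and propagation. -/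
inductive Forced (D : Digraph V) : V → V → Prop
  | collider {a b c : V} : D.Adj a b → D.Adj c b → a ≠ c → ¬ Sk D a c → Forced D a b
  | chain {a b c : V} : Forced D a b → D.Adj b c → ¬ Sk D a c → Forced D b c
  | triangle {a b c : V} : Forced D a b → Forced D b c → D.Adj a c → Forced D a c
  | diamond {a b c d : V} : Forced D c b → Forced D d b → c ≠ d → ¬ Sk D c d → D.Adj a b →
      Sk D a c → Sk D a d → ¬ (D.Adj c a ∧ D.Adj d a) → Forced D a b

/-- The adjacencies of `D` that are not forced in either direction. -/
def Free (D : Digraph V) (a b : V) : Prop := Sk D a b ∧ ¬ Forced D a b ∧ ¬ Forced D b a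

theorem Free.symm {D : Digraph V} {a b : V} (h : Free D a b) : Free D b a :=
  ⟨h.1.symm, h.2.2, h.2.1⟩

namespace Forced

variable {D D' : Digraph V} {a b c : V}

theorem adj (h : Forced D a b) : D.Adj a b := by
  cases h <;> first | assumption

theorem adj_of_sameSkelColl (hD : IsDAG D) (hD' : IsDAG D') (hV : SameSkelColl D D')
    (h : Forced D a b) : D'.Adj a b := by
  induction h with
  | collider h1 h2 h3 h4 => exact ((hV.coll _ _ _ h3 h4).1 ⟨h1, h2⟩).1
  | chain h1 h2 h3 ih =>
    refine hV.adj_of_unshielded hD ih h2 h3 ?_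
    rintro rfl
    exact hD.asymm h1.adj h2
  | triangle h1 h2 h3 ih1 ih2 => exact hD'.trans_of_sk ih1 ih2 ((hV.sk _ _).1 (.inl h3))
  | diamond h1 h2 h3 h4 h5 h6 h7 h8 ih1 ih2 =>
    refine ((hV.sk _ _).1 (.inl h5)).resolve_right fun h9 => h8 ?_
    exact (hV.coll _ _ _ h3 h4).2 ⟨hD'.trans_of_sk ih1 h9 ((hV.sk _ _).1 h6.symm),
      hD'.trans_of_sk ih2 h9 ((hV.sk _ _).1 h7.symm)⟩

/-- If `a → b` is forced and `b — c` is free, then `a → c` is forced. -/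
theorem of_free (hD : IsDAG D) (h : Forced D a b) : ∀ {c : V}, Free D b c → Forced D a c := by
  have ne : ∀ {a b c}, Forced D a b → Free D b c → a ≠ c := by
    rintro a b _ h1 h2 rfl
    exact h2.2.2 h1
  have sk : ∀ {a b c}, Forced D a b → Free D b c → Sk D a c := by
    intro a b c h1 h2
    by_contra hs
    rcases h2.1 with h3 | h3
    · exact h2.2.1 (.chain h1 h3 hs)
    · exact h2.2.2 (.collider h3 h1.adj (ne h1 h2).symm fun h4 => hs h4.symm)
  have key : ∀ {a b c}, Forced D a b → Free D b c → (Free D a c → False) → Forced D a c := by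
    intro a b c h1 h2 h3
    by_contra h4
    refine h3 ⟨sk h1 h2, h4, fun h5 => h2.2.2 (.triangle h5 h1 ?_)⟩
    exact hD.trans_of_sk h5.adj h1.adj h2.1.symm
  induction h with
  | @collider a b d h1 h2 h3 h4 =>
    intro c hc
    have hab : Forced D a b := .collider h1 h2 h3 h4
    have hdb : Forced D d b := .collider h2 h1 h3.symm fun h => h4 h.symm
    refine key hab hc fun hf => ?_
    have hdc := sk hdb hc
    have hn : ¬ (D.Adj a c ∧ D.Adj d c) := fun h => hf.2.1 (.collider h.1 h.2 h3 h4)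
    refine hc.2.2 (.diamond hab hdb h3 h4 (hc.1.resolve_left fun hbc => hn ?_) hf.1.symm
      hdc.symm hn)
    exact ⟨hD.trans_of_sk h1 hbc hf.1, hD.trans_of_sk h2 hbc hdc⟩
  | @chain d a b h1 h2 h3 ih =>
    intro c hc
    refine key (.chain h1 h2 h3) hc fun hf => ?_
    have hdc := ih hf
    have hdb : d ≠ b := by
      rintro rfl
      exact hD.asymm h1.adj h2
    rcases hc.1 with hbc | hcb
    · exact hc.2.1 (.collider hbc hdc.adj hdb.symm fun h => h3 h.symm)
    · exact hc.2.2 (.chain hdc hcb h3)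
  | @triangle a d b h1 h2 h3 ih1 ih2 =>
    intro c hc
    refine key (.triangle h1 h2 h3) hc fun hf => hf.2.1 ?_
    have h4 := ih2 hc
    exact .triangle h1 h4 (hD.trans_of_sk h1.adj h4.adj hf.1)
  | @diamond a b x y h1 h2 h3 h4 h5 h6 h7 h8 ih1 ih2 =>
    intro c hc
    refine key (.diamond h1 h2 h3 h4 h5 h6 h7 h8) hc fun hf => hf.2.1 ?_
    have hx := ih1 hc
    have hy := ih2 hc
    refine .diamond hx hy h3 h4 (hf.1.resolve_right fun hca => h8 ?_) h6 h7 h8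
    exact ⟨hD.trans_of_sk hx.adj hca h6.symm, hD.trans_of_sk hy.adj hca h7.symm⟩

end Forced

theorem Free.trans_collider {D : Digraph V} (hD : IsDAG D) {a b c : V} (hab : D.Adj a b)
    (hcb : D.Adj c b) (hac : a ≠ c) (h1 : Free D a b) (h2 : Free D c b) : Free D a c := by
  refine ⟨?_, fun h => h1.2.1 (h.of_free hD h2), fun h => h2.2.1 (h.of_free hD h1)⟩
  by_contra hs
  exact h1.2.1 (.collider hab hcb hac hs)

section Elimination

variable {U : V → V → Prop}

/-- `u` is simplicial in the subgraph induced on `S`. -/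
def Simplicial (U : V → V → Prop) (S : Finset V) (u : V) : Prop :=
  ∀ a ∈ S, ∀ b ∈ S, U u a → U u b → a ≠ b → U a b

/-- Every nonempty induced subgraph has a simplicial vertex. -/
def Eliminable (U : V → V → Prop) : Prop :=
  ∀ S : Finset V, S.Nonempty → ∃ s ∈ S, Simplicial U S s

/-- The vertices of `Q` are pairwise adjacent. -/
def IsCliqueOn (U : V → V → Prop) (Q : Finset V) : Prop := ∀ a ∈ Q, ∀ b ∈ Q, a ≠ b → U a b

theorem Eliminable.exists_not_mem [DecidableEq V] (hU : Eliminable U) (hsymm : ∀ a b, U a b → U b a)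
    (S : Finset V) : ∀ Q ⊆ S, Q ≠ S → IsCliqueOn U Q → ∃ u ∈ S, u ∉ Q ∧ Simplicial U S u := by
  induction S using Finset.strongInduction with
  | H S ih =>
    intro Q hQS hne hQ
    obtain ⟨u, huS, huQ⟩ := Finset.exists_of_ssubset (hQS.ssubset_of_ne hne)
    obtain ⟨s, hsS, hs⟩ := hU S ⟨u, huS⟩
    by_cases hsQ : s ∉ Q
    · exact ⟨s, hsS, hsQ, hs⟩
    rw [not_not] at hsQ
    classical
    by_cases hall : ∀ x ∈ S, x ≠ s → U s x
    · refine ⟨u, huS, huQ, fun a ha b hb hua hub hab => ?_⟩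
      by_cases has : a = s
      · subst has
        exact hall b hb (Ne.symm hab)
      by_cases hbs : b = s
      · subst hbs
        exact hsymm _ _ (hall a ha hab)
      · exact hs a ha b hb (hall a ha has) (hall b hb hbs) hab
    · push Not at hall
      obtain ⟨x, hxS, hxs, hsx⟩ := hall
      obtain ⟨u, hu, huN, hsim⟩ := ih (S.erase s) (Finset.erase_ssubset hsS)
        ((S.erase s).filter (U s)) (Finset.filter_subset _ _)
        (fun h => hsx (Finset.filter_eq_self.1 h x (Finset.mem_erase.2 ⟨hxs, hxS⟩)))
        (fun a ha b hb hab => by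
          simp only [Finset.mem_filter, Finset.mem_erase] at ha hb
          exact hs a ha.1.2 b hb.1.2 ha.2 hb.2 hab)
      have hus : u ≠ s := (Finset.mem_erase.1 hu).1
      have hnadj : ¬ U s u := fun h => huN (Finset.mem_filter.2 ⟨hu, h⟩)
      refine ⟨u, (Finset.mem_erase.1 hu).2, fun h => hnadj (hQ s hsQ u h hus.symm),
        fun a ha b hb hua hub hab => ?_⟩
      have hn : ∀ a, U u a → a ≠ s := by
        rintro a h rfl
        exact hnadj (hsymm _ _ h)
      exact hsim a (Finset.mem_erase.2 ⟨hn a hua, ha⟩) b (Finset.mem_erase.2 ⟨hn b hub, hb⟩)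
        hua hub hab

/-- A graph with a perfect elimination ordering has one starting with any given ordered clique. -/
theorem Eliminable.exists_rank [DecidableEq V] (hU : Eliminable U) (hsymm : ∀ a b, U a b → U b a)
    (Q : Finset V) (hQ : IsCliqueOn U Q) (r : V → ℕ) (hr : Set.InjOn r Q) (S : Finset V) :
    Q ⊆ S → ∃ ρ : V → ℕ, Set.InjOn ρ S ∧ (∀ a ∈ Q, ρ a = r a) ∧
      ∀ a ∈ S, ∀ b ∈ S, ∀ c ∈ S, U a b → U c b → ρ a < ρ b → ρ c < ρ b → a ≠ c → U a c := by
  induction S using Finset.strongInduction with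
  | H S ih =>
    intro hQS
    by_cases hne : Q = S
    · subst hne
      exact ⟨r, hr, fun _ _ => rfl, fun a ha _ _ c hc _ _ _ _ hac => hQ a ha c hc hac⟩
    obtain ⟨u, huS, huQ, hu⟩ := hU.exists_not_mem hsymm S Q hQS hne hQ
    obtain ⟨ρ, h1, h2, h3⟩ := ih (S.erase u) (Finset.erase_ssubset huS)
      fun x hx => Finset.mem_erase.2 ⟨fun h => huQ (h ▸ hx), hQS hx⟩
    have hlt : ∀ x ∈ S, ρ x < S.sup ρ + 1 := fun x hx => Nat.lt_succ_of_le (Finset.le_sup hx)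
    have hu' : Function.update ρ u (S.sup ρ + 1) u = S.sup ρ + 1 := Function.update_self ..
    have hx' : ∀ x, x ≠ u → Function.update ρ u (S.sup ρ + 1) x = ρ x :=
      fun x hx => Function.update_of_ne hx ..
    refine ⟨Function.update ρ u (S.sup ρ + 1), ?_, ?_, ?_⟩
    · intro x hx y hy hxy
      by_cases hxu : x = u
      · by_cases hyu : y = u
        · rw [hxu, hyu]
        · rw [hxu, hu', hx' y hyu] at hxy
          exact absurd hxy (hlt y hy).ne'
      · by_cases hyu : y = u
        · rw [hyu, hu', hx' x hxu] at hxy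
          exact absurd hxy (hlt x hx).ne
        · rw [hx' x hxu, hx' y hyu] at hxy
          exact h1 (Finset.mem_coe.2 (Finset.mem_erase.2 ⟨hxu, hx⟩))
            (Finset.mem_coe.2 (Finset.mem_erase.2 ⟨hyu, hy⟩)) hxy
    · intro a ha
      rw [hx' a fun h => huQ (h ▸ ha)]
      exact h2 a ha
    · intro a ha b hb c hc hab hcb hlab hlcb hac
      by_cases hbu : b = u
      · subst hbu
        exact hu a ha c hc (hsymm _ _ hab) (hsymm _ _ hcb) hac
      · have hne : ∀ x ∈ S, Function.update ρ u (S.sup ρ + 1) x <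
            Function.update ρ u (S.sup ρ + 1) b → x ≠ u := by
          rintro x - hlt' rfl
          rw [hu', hx' b hbu] at hlt'
          exact absurd hlt' (hlt b hb).not_gt
        have hau := hne a ha hlab
        have hcu := hne c hc hlcb
        rw [hx' a hau, hx' b hbu] at hlab
        rw [hx' c hcu, hx' b hbu] at hlcb
        exact h3 a (Finset.mem_erase.2 ⟨hau, ha⟩) b (Finset.mem_erase.2 ⟨hbu, hb⟩) c
          (Finset.mem_erase.2 ⟨hcu, hc⟩) hab hcb hlab hlcb hac

/-- The endpoints of an edge lying on a cycle have a common neighbour. -/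
theorem Eliminable.exists_common [DecidableEq V] (hU : Eliminable U) (hsymm : ∀ a b, U a b → U b a)
    (hirr : ∀ a, ¬ U a a) {v w : V} (hvw : U v w) (S : Finset V) :
    v ∈ S → w ∈ S →
      ReflTransGen (fun a b => b ∈ S ∧ U a b ∧ ¬ (a = v ∧ b = w ∨ a = w ∧ b = v)) v w →
      ∃ t, U v t ∧ U t w := by
  induction S using Finset.strongInduction with
  | H S ih =>
    intro hv hw hpath
    have hne : v ≠ w := by
      rintro rfl
      exact hirr _ hvw
    by_cases hS : {v, w} = S
    · exfalso
      have : ∀ x, ReflTransGen (fun a b => b ∈ S ∧ U a b ∧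
          ¬ (a = v ∧ b = w ∨ a = w ∧ b = v)) v x → x = v := by
        intro x hx
        induction hx with
        | refl => rfl
        | tail _ h ih =>
          obtain ⟨h1, h2, h3⟩ := h
          subst ih
          rw [← hS] at h1
          simp only [Finset.mem_insert, Finset.mem_singleton] at h1
          refine h1.resolve_right fun h4 => h3 (.inl ⟨rfl, h4⟩)
      exact hne (this w hpath).symm
    obtain ⟨u, huS, huQ, hu⟩ := hU.exists_not_mem hsymm S {v, w}
      (by simp [Finset.insert_subset_iff, hv, hw]) hS (by
        intro a ha b hb hab
        simp only [Finset.mem_insert, Finset.mem_singleton] at ha hb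
        rcases ha with rfl | rfl <;> rcases hb with rfl | rfl
        · exact absurd rfl hab
        · exact hvw
        · exact hsymm _ _ hvw
        · exact absurd rfl hab)
    simp only [Finset.mem_insert, Finset.mem_singleton, not_or] at huQ
    by_contra hcon
    have hnot : ∀ a b, U u a → U u b → ¬ (a = v ∧ b = w ∨ a = w ∧ b = v) := by
      rintro a b ha hb (⟨rfl, rfl⟩ | ⟨rfl, rfl⟩)
      · exact hcon ⟨u, hsymm _ _ ha, hb⟩
      · exact hcon ⟨u, hsymm _ _ hb, ha⟩
    refine hcon (ih (S.erase u) (Finset.erase_ssubset huS)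
      (Finset.mem_erase.2 ⟨Ne.symm huQ.1, hv⟩) (Finset.mem_erase.2 ⟨Ne.symm huQ.2, hw⟩) ?_)
    have key : ∀ x, ReflTransGen (fun a b => b ∈ S ∧ U a b ∧
        ¬ (a = v ∧ b = w ∨ a = w ∧ b = v)) v x → x ∈ S ∧ ∀ y ∈ S, y ≠ u → (y = x ∨ x = u ∧ U u y) →
        ReflTransGen (fun a b => b ∈ S.erase u ∧ U a b ∧
          ¬ (a = v ∧ b = w ∨ a = w ∧ b = v)) v y := by
      intro x hx
      induction hx with
      | refl =>
        refine ⟨hv, ?_⟩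
        rintro y - - (rfl | ⟨h, -⟩)
        · exact .refl
        · exact absurd h.symm huQ.1
      | @tail x x' _ h ih =>
        obtain ⟨h1, h2, h3⟩ := h
        obtain ⟨hxS, ih⟩ := ih
        refine ⟨h1, ?_⟩
        rintro y hyS hyu (rfl | ⟨rfl, huy⟩)
        · by_cases hxu : x = u
          · subst hxu
            exact ih y hyS hyu (.inr ⟨rfl, h2⟩)
          · exact (ih x hxS hxu (.inl rfl)).tail ⟨Finset.mem_erase.2 ⟨hyu, hyS⟩, h2, h3⟩
        · have hxu : x ≠ x' := by
            rintro rfl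
            exact hirr _ h2
          have h4 := ih x hxS hxu (.inl rfl)
          by_cases hxy : y = x
          · rwa [hxy]
          · exact h4.tail ⟨Finset.mem_erase.2 ⟨hyu, hyS⟩,
              hu x hxS y hyS (hsymm _ _ h2) huy (Ne.symm hxy), hnot x y (hsymm _ _ h2) huy⟩
    exact (key w hpath).2 w hw (Ne.symm huQ.2) (.inl rfl)

end Elimination

theorem Free.irrefl {D : Digraph V} (hD : IsDAG D) (a : V) : ¬ Free D a a := fun h => by
  rcases h.1 with h | h <;> exact hD.irrefl h

theorem eliminable_free [Finite V] {D : Digraph V} (hD : IsDAG D) : Eliminable (Free D) := by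
  intro S hS
  obtain ⟨s, hs, hmax⟩ := hD.exists_maximal (S : Set V) hS
  refine ⟨s, hs, fun a ha b hb hsa hsb hab => ?_⟩
  exact Free.trans_collider hD (hsa.1.resolve_left (hmax a ha)) (hsb.1.resolve_left (hmax b hb))
    hab hsa.symm hsb.symm

/-- The forced edges of `D` together with the free edges oriented by increasing rank. -/
def reorient (D : Digraph V) (ρ : V → ℕ) : Digraph V :=
  ⟨fun a b => Forced D a b ∨ Free D a b ∧ ρ a < ρ b⟩

theorem isDAG_reorient {D : Digraph V} (hD : IsDAG D) (ρ : V → ℕ) : IsDAG (reorient D ρ) := by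
  have h1 : ∀ {a b c}, Forced D a b → ReflTransGen (reorient D ρ).Adj b c →
      ∃ y, ReflTransGen (Forced D) a y ∧ Forced D y c := by
    intro a b c hab hbc
    induction hbc with
    | refl => exact ⟨a, .refl, hab⟩
    | tail _ h ih =>
      obtain ⟨y, hy, hyc⟩ := ih
      rcases h with h | ⟨h, -⟩
      · exact ⟨_, hy.tail hyc, h⟩
      · exact ⟨y, hy, hyc.of_free hD h⟩
  have h2 : ∀ {a b}, Forced D a b → ¬ ReflTransGen (reorient D ρ).Adj b a := by
    intro a b hab hba
    obtain ⟨y, hy, hya⟩ := h1 hab hba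
    exact hD.no_cycle hya.adj (ReflTransGen.mono (fun _ _ h => h.adj) _ _ hy)
  have h3 : ∀ {a b}, TransGen (reorient D ρ).Adj a b → ρ a < ρ b ∨
      ∃ x y, ReflTransGen (reorient D ρ).Adj a x ∧ Forced D x y ∧
        ReflTransGen (reorient D ρ).Adj y b := by
    intro a b hab
    induction hab with
    | single h =>
      rcases h with h | h
      · exact .inr ⟨_, _, .refl, h, .refl⟩
      · exact .inl h.2
    | @tail b c hb h ih =>
      rcases ih with ih | ⟨x, y, hx, hxy, hy⟩
      · rcases h with h | h
        · exact .inr ⟨b, c, hb.to_reflTransGen, h, .refl⟩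
        · exact .inl (ih.trans h.2)
      · exact .inr ⟨x, y, hx, hxy, hy.tail h⟩
  intro a ha
  rcases h3 ha with h | ⟨x, y, hx, hxy, hy⟩
  · exact h.false
  · exact h2 hxy (hy.trans hx)

theorem sameSkelColl_reorient {D : Digraph V} (hD : IsDAG D) {ρ : V → ℕ}
    (hinj : Function.Injective ρ)
    (hρ : ∀ a b c, Free D a b → Free D c b → ρ a < ρ b → ρ c < ρ b → a ≠ c → Free D a c) :
    SameSkelColl D (reorient D ρ) := by
  have hsk : ∀ a b, Sk D a b ↔ Sk (reorient D ρ) a b := by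
    intro a b
    constructor
    · intro h
      by_cases h1 : Forced D a b
      · exact .inl (.inl h1)
      by_cases h2 : Forced D b a
      · exact .inr (.inl h2)
      have hf : Free D a b := ⟨h, h1, h2⟩
      have hne : a ≠ b := by
        rintro rfl
        exact hf.irrefl hD
      rcases lt_or_gt_of_ne (hinj.ne hne) with hl | hl
      · exact .inl (.inr ⟨hf, hl⟩)
      · exact .inr (.inr ⟨hf.symm, hl⟩)
    · rintro ((h | h) | (h | h))
      · exact .inl h.adj
      · exact h.1.1
      · exact .inr h.adj
      · exact h.1.1.symm
  refine ⟨hsk, fun a b c hac hs => ⟨fun h => ?_, fun h => ?_⟩⟩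
  · exact ⟨.inl (.collider h.1 h.2 hac hs), .inl (.collider h.2 h.1 hac.symm fun h => hs h.symm)⟩
  · rcases h with ⟨h1 | h1, h2 | h2⟩
    · exact ⟨h1.adj, h2.adj⟩
    · exact absurd (.inl (h1.of_free hD h2.1.symm).adj) hs
    · exact absurd (.inr (h2.of_free hD h1.1.symm).adj) hs
    · exact absurd (hρ a b c h1.1 h2.1 h1.2 h2.2 hac).1 hs

/-- Free edges can be reoriented so that a given free clique has a prescribed order. -/
theorem exists_reorient [Finite V] {D : Digraph V} (hD : IsDAG D) (Q : Finset V)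
    (hQ : IsCliqueOn (Free D) Q) (r : V → ℕ) (hr : Set.InjOn r Q) :
    ∃ D' : Digraph V, IsDAG D' ∧ MarkovEquiv D D' ∧
      ∀ a ∈ Q, ∀ b ∈ Q, r a < r b → D'.Adj a b := by
  classical
  cases nonempty_fintype V
  obtain ⟨ρ, h1, h2, h3⟩ := (eliminable_free hD).exists_rank (fun _ _ h => h.symm) Q hQ r hr
    Finset.univ (Finset.subset_univ _)
  have hV := sameSkelColl_reorient hD (ρ := ρ) (fun a b h => h1 (by simp) (by simp) h)
    fun a b c => h3 a (by simp) b (by simp) c (by simp)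
  have hD' := isDAG_reorient hD ρ
  refine ⟨_, hD', hV.markovEquiv hD hD', fun a ha b hb hab => .inr ⟨hQ a ha b hb ?_, ?_⟩⟩
  · rintro rfl
    exact hab.false
  · rwa [h2 a ha, h2 b hb]

namespace IsEssentialGraphOf

variable {G D D' : Digraph V}

theorem of_markovEquiv (h : IsEssentialGraphOf G D) (hD' : IsDAG D') (hM : MarkovEquiv D D') :
    IsEssentialGraphOf G D' :=
  ⟨hD', fun a b => (h.2 a b).trans
    ⟨fun ⟨E, h1, h2, h3⟩ => ⟨E, h1, hM.symm.trans h2, h3⟩,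
      fun ⟨E, h1, h2, h3⟩ => ⟨E, h1, hM.trans h2, h3⟩⟩⟩

theorem adj_of_adj (h : IsEssentialGraphOf G D) {a b : V} (hab : D.Adj a b) : G.Adj a b :=
  (h.2 a b).2 ⟨D, h.1, fun _ _ _ _ _ _ => Iff.rfl, hab⟩

theorem forced_or_free (h : IsEssentialGraphOf G D) {a b : V} (hab : G.Adj a b) :
    Forced D a b ∨ Free D a b := by
  obtain ⟨E, hE, hM, hE'⟩ := (h.2 a b).1 hab
  have hV := hM.sameSkelColl h.1 hE
  by_cases h1 : Forced D a b
  · exact .inl h1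
  · exact .inr ⟨(hV.sk a b).2 (.inl hE'), h1, fun h2 =>
      hE.asymm hE' (h2.adj_of_sameSkelColl h.1 hE hV)⟩

theorem exists_adj_of_free [Finite V] (h : IsEssentialGraphOf G D) {a b : V} (hab : Free D a b) :
    ∃ D', IsDAG D' ∧ MarkovEquiv D D' ∧ D'.Adj a b := by
  classical
  have hne : a ≠ b := by
    rintro rfl
    exact hab.irrefl h.1
  obtain ⟨D', h1, h2, h3⟩ := exists_reorient h.1 {a, b}
    (by
      intro x hx y hy hxy
      simp only [Finset.mem_insert, Finset.mem_singleton] at hx hy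
      rcases hx with rfl | rfl <;> rcases hy with rfl | rfl
      exacts [absurd rfl hxy, hab, hab.symm, absurd rfl hxy])
    (fun x => if x = a then 0 else 1)
    (by
      intro x hx y hy hxy
      simp only [Finset.coe_insert, Finset.coe_singleton, Set.mem_insert_iff,
        Set.mem_singleton_iff] at hx hy
      rcases hx with rfl | rfl <;> rcases hy with rfl | rfl <;> simp_all)
  exact ⟨D', h1, h2, h3 a (by simp) b (by simp) (by simp [hne.symm])⟩

theorem exists_adj_of_free_triangle [Finite V] (h : IsEssentialGraphOf G D) {a b c : V}
    (hab : Free D a b) (hbc : Free D b c) (hac : Free D a c) :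
    ∃ D', IsDAG D' ∧ MarkovEquiv D D' ∧ D'.Adj a b ∧ D'.Adj b c ∧ D'.Adj a c := by
  classical
  have ne : ∀ {a b}, Free D a b → a ≠ b := by
    rintro a _ hab rfl
    exact hab.irrefl h.1
  have h1 := ne hab
  have h2 := ne hbc
  have h3 := ne hac
  obtain ⟨D', h4, h5, h6⟩ := exists_reorient h.1 {a, b, c}
    (by
      intro x hx y hy hxy
      simp only [Finset.mem_insert, Finset.mem_singleton] at hx hy
      rcases hx with rfl | rfl | rfl <;> rcases hy with rfl | rfl | rfl
      exacts [absurd rfl hxy, hab, hac, hab.symm, absurd rfl hxy, hbc, hac.symm, hbc.symm,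
        absurd rfl hxy])
    (fun x => if x = a then 0 else if x = b then 1 else 2)
    (by
      intro x hx y hy hxy
      simp only [Finset.coe_insert, Finset.coe_singleton, Set.mem_insert_iff,
        Set.mem_singleton_iff] at hx hy
      rcases hx with rfl | rfl | rfl <;> rcases hy with rfl | rfl | rfl <;>
        first | rfl | (simp [h1.symm, h2.symm, h3.symm] at hxy))
  refine ⟨D', h4, h5, h6 a (by simp) b (by simp) ?_, h6 b (by simp) c (by simp) ?_,
    h6 a (by simp) c (by simp) ?_⟩ <;> simp [h1.symm, h2.symm, h3.symm]

theorem adj_of_free [Finite V] (h : IsEssentialGraphOf G D) {a b : V} (hab : Free D a b) :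
    G.Adj a b :=
  (h.2 a b).2 (h.exists_adj_of_free hab)

end IsEssentialGraphOf

section Unconditional

variable {D : Digraph V}

/-- Without conditioning, open walks exist exactly between nodes with a common ancestor. -/
theorem exists_openWalk_empty_iff (hD : IsDAG D) (a b : V) :
    (∃ n f, OpenWalk D ∅ a b n f) ↔
      ∃ c, ReflTransGen D.Adj c a ∧ ReflTransGen D.Adj c b := by
  constructor
  · rintro ⟨n, f, hf⟩
    have key : ∀ j ≤ n, ReflTransGen D.Adj (f j) (f 0) ∨
        ∃ c, ReflTransGen D.Adj c (f 0) ∧ ReflTransGen D.Adj c (f n) := by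
      intro j
      induction j with
      | zero => exact fun _ => .inl .refl
      | succ j ih =>
        intro hj
        rcases ih (by omega) with h1 | h1
        · rcases hf.sk j hj with h2 | h2
          · rcases hf.forward h2 (n - j - 1) (by omega) with ⟨_, -, h3⟩ | ⟨h3, -⟩
            · exact h3.elim
            · rw [show j + (n - j - 1) + 1 = n by omega] at h3
              exact .inr ⟨_, h1, h3⟩
          · exact .inl (.head h2 h1)
        · exact .inr h1
    rw [← hf.start, ← hf.finish]
    rcases key n le_rfl with h | h
    · exact ⟨_, h, .refl⟩
    · exact h
  · rintro ⟨c, hca, hcb⟩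
    have h1 : ∃ n f, OpenWalk D ∅ a c n f ∧ ∀ i < n, D.Adj (f (i + 1)) (f i) := by
      clear hcb
      induction hca using ReflTransGen.head_induction_on with
      | refl => exact ⟨0, fun _ => a, ⟨rfl, rfl, fun i hi => by omega, fun i hi => by omega⟩,
          fun i hi => by omega⟩
      | @head x y hxy _ ih =>
        obtain ⟨n, f, hf, hb⟩ := ih
        refine ⟨n + 1, _, hf.snoc (.inr hxy) ?_, fun i hi => ?_⟩
        · rintro m rfl
          have := hb m (by omega)
          rw [hf.finish] at this
          exact ShortestWalk.openAt_of_out_left hD (Set.notMem_empty _) this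
        · rcases eq_or_lt_of_le (show i ≤ n by omega) with rfl | hi'
          · rw [if_pos le_rfl, if_neg (by omega), hf.finish]
            exact hxy
          · rw [if_pos hi'.le, if_pos (by omega)]
            exact hb i hi'
    induction hcb with
    | refl =>
      obtain ⟨n, f, hf, -⟩ := h1
      exact ⟨n, f, hf⟩
    | tail _ h ih =>
      obtain ⟨n, f, hf⟩ := ih
      exact ⟨n + 1, _, hf.snoc (.inl h) fun _ _ =>
        ShortestWalk.openAt_of_out_right hD (Set.notMem_empty _) h⟩

theorem dSep_empty_iff (hD : IsDAG D) (A B : Set V) :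
    DSep D A B ∅ ↔ ∀ a ∈ A, ∀ b ∈ B,
      ¬ ∃ c, ReflTransGen D.Adj c a ∧ ReflTransGen D.Adj c b := by
  rw [dSep_iff]
  simp only [exists_openWalk_empty_iff hD]

theorem isDAG_delEdge (hD : IsDAG D) (v w : V) : IsDAG (delEdge D v w) :=
  fun a h => hD a (TransGen.mono (fun _ _ h => h.1) _ _ h)

theorem reach_delEdge {s y v w : V} (h : ReflTransGen D.Adj s y)
    (hy : ¬ ReflTransGen D.Adj w y) : ReflTransGen (delEdge D v w).Adj s y := by
  induction h with
  | refl => exact .refl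
  | tail _ h ih =>
    refine (ih fun h' => hy (h'.tail h)).tail ⟨h, ?_⟩
    rintro ⟨-, rfl⟩
    exact hy .refl

/-- Deleting `v → w` preserves unconditional equivalence iff every source above `v` is still
above `w`. -/
theorem uncondEquivSep_delEdge_iff [Finite V] (hD : IsDAG D) {v w : V} (hvw : D.Adj v w) :
    UncondEquivSep D (delEdge D v w) ↔ ∀ s, (∀ t, ¬ D.Adj t s) → ReflTransGen D.Adj s v →
      ReflTransGen (delEdge D v w).Adj s w := by
  have hle : ∀ {a b}, ReflTransGen (delEdge D v w).Adj a b → ReflTransGen D.Adj a b :=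
    fun h => ReflTransGen.mono (fun _ _ h => h.1) _ _ h
  constructor
  · intro h s hs hsv
    have hne : s ≠ w := by
      rintro rfl
      exact hs v hvw
    by_contra hcon
    have h1 := (h {s} {w} (by simpa using hne)).2
    rw [dSep_empty_iff hD, dSep_empty_iff (isDAG_delEdge hD v w)] at h1
    refine h1 ?_ s rfl w rfl ⟨s, .refl, hsv.tail hvw⟩
    rintro _ rfl _ rfl ⟨c, hcs, hcw⟩
    rcases hcs.cases_tail with rfl | ⟨t, -, ht⟩
    · exact hcon hcw
    · exact hs t ht.1
  · intro h A B _
    rw [dSep_empty_iff hD, dSep_empty_iff (isDAG_delEdge hD v w)]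
    refine forall₂_congr fun a _ => forall₂_congr fun b _ => not_congr ⟨?_, ?_⟩
    · rintro ⟨c, hca, hcb⟩
      obtain ⟨s, hsc, hs⟩ := hD.exists_source c
      have key : ∀ {x}, ReflTransGen D.Adj s x → ReflTransGen (delEdge D v w).Adj s x := by
        intro x hx
        induction hx with
        | refl => exact .refl
        | @tail y z hy hyz ih =>
          by_cases hc : y = v ∧ z = w
          · rw [hc.2]
            exact h s hs (hc.1 ▸ hy)
          · exact ih.tail ⟨hyz, hc⟩
      exact ⟨s, key (hsc.trans hca), key (hsc.trans hcb)⟩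
    · rintro ⟨c, hca, hcb⟩
      exact ⟨c, hle hca, hle hcb⟩

end Unconditional

section Reachability

variable {D : Digraph V}

theorem Forced.of_reach_free (hD : IsDAG D) {a b c : V} (h : Forced D a b)
    (hbc : ReflTransGen (Free D) b c) : Forced D a c := by
  induction hbc with
  | refl => exact h
  | tail _ hf ih => exact ih.of_free hD hf

/-- A source of `D` reaching `u` in a partially directed graph reaches `u` in `D`, even after
deleting edges that take part in no free detour. -/
theorem reach_of_source (hD : IsDAG D) {s : V} (hs : ∀ t, ¬ D.Adj t s) {R H : V → V → Prop}
    (hR : ∀ {a b}, R a b → D.Adj a b) (hH : ∀ {a b}, H a b → R a b ∨ R b a ∧ Free D a b)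
    (hdel : ∀ {a b}, D.Adj a b → ¬ R a b → Forced D a b ∧ ∀ u, ¬ (Forced D a u ∧ Free D u b))
    {u : V} (h : ReflTransGen H s u) : ReflTransGen R s u := by
  have key : ∀ {u u'}, ReflTransGen R s u → R u' u → Free D u u' → ReflTransGen R s u' := by
    intro u u' hu
    induction hu with
    | refl => exact fun h1 _ => (hs _ (hR h1)).elim
    | @tail y u hy hyu ih =>
      intro h1 h2
      by_cases hne : y = u'
      · exact hne ▸ hy
      by_cases hf : Forced D y u
      · have hf' := hf.of_free hD h2
        refine hy.tail ?_
        by_contra hn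
        exact (hdel hf'.adj hn).2 u ⟨hf, h2⟩
      have hyu' : Free D y u :=
        ⟨.inl (hR hyu), hf, fun h => hD.asymm (hR hyu) h.adj⟩
      have h3 := Free.trans_collider hD (hR hyu) (hR h1) hne hyu' h2.symm
      rcases h3.1 with h4 | h4
      · refine hy.tail ?_
        by_contra hn
        exact h3.2.1 (hdel h4 hn).1
      · refine ih ?_ h3
        by_contra hn
        exact h3.2.2 (hdel h4 hn).1
  induction h with
  | refl => exact .refl
  | tail _ h ih =>
    rcases hH h with h | ⟨h, hf⟩
    · exact ih.tail h
    · exact key ih h hf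

/-- Everything above a node without forced parents is connected to it by free edges. -/
theorem free_reach_of_reach (hD : IsDAG D) {s x : V} (hs : ∀ y, ¬ Forced D y s)
    {H : V → V → Prop} (hH : ∀ {a b}, H a b → Forced D a b ∨ Free D a b ∧ H b a)
    (h : ReflTransGen H x s) : ReflTransGen (fun a b => H a b ∧ Free D a b) s x := by
  induction h using ReflTransGen.head_induction_on with
  | refl => exact .refl
  | head h _ ih =>
    rcases hH h with h | ⟨h1, h2⟩
    · refine (hs _ (h.of_reach_free hD ?_)).elim
      have : Std.Symm (Free D) := ⟨fun _ _ h => h.symm⟩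
      exact Std.Symm.symm _ _ (ReflTransGen.mono (fun _ _ h => h.2) _ _ ih)
    · exact ih.tail ⟨h2, h1.symm⟩

/-- If `u` has a forced parent, every source above `u` lies above some forced parent of `u`. -/
theorem exists_forced_parent (hD : IsDAG D) {s u : V} (hs : ∀ t, ¬ D.Adj t s)
    (h : ReflTransGen D.Adj s u) : ∀ {y}, Forced D y u →
      ∃ y', Forced D y' u ∧ ReflTransGen D.Adj s y' := by
  induction h with
  | refl => exact fun h => (hs _ h.adj).elim
  | @tail x u hx hxu ih =>
    intro y hy
    by_cases hf : Forced D x u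
    · exact ⟨x, hf, hx⟩
    have hfree : Free D x u := ⟨.inl hxu, hf, fun h => hD.asymm hxu h.adj⟩
    obtain ⟨y', h1, h2⟩ := ih (hy.of_free hD hfree.symm)
    exact ⟨y', h1.of_free hD hfree, h2⟩

end Reachability

theorem removable_imp_mt_subset [Finite V] {G D : Digraph V} (hE : IsEssentialGraphOf G D)
    {v w : V} (hvw : D.Adj v w) (hU : UncondEquivSep D (delEdge D v w)) :
    mt (removeBetween G v w) v ⊆ mt (removeBetween G v w) w := by
  rintro x ⟨hxv, hx⟩
  have hD := hE.1
  have hle : ∀ {a b}, ReflTransGen (delEdge D v w).Adj a b →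
      ReflTransGen (removeBetween G v w).Adj a b := by
    refine fun h => ReflTransGen.mono (fun a b h => ⟨hE.adj_of_adj h.1, ?_⟩) _ _ h
    rintro (h' | ⟨rfl, rfl⟩)
    · exact h.2 h'
    · exact hD.asymm h.1 hvw
  refine ⟨?_, hx⟩
  obtain ⟨s, hsx, hs⟩ := (isDAG_delEdge hD v w).exists_source x
  have hsx' : s ∈ att (removeBetween G v w) x := hle hsx
  rw [hx] at hsx'
  have hxs : ReflTransGen (removeBetween G v w).Adj x s := hsx'.1
  by_cases hsw : s = w
  · exact hsw ▸ hxs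
  have hs' : ∀ t, ¬ D.Adj t s := fun t ht => hs t ⟨ht, fun h => hsw h.2⟩
  refine hxs.trans (hle ((uncondEquivSep_delEdge_iff hD hvw).1 hU s hs' ?_))
  refine reach_of_source hD hs' (H := (removeBetween G v w).Adj) (fun h => h) (fun h => ?_)
    (fun h h' => absurd h h') ((hle hsx).trans hxv)
  rcases hE.forced_or_free h.1 with h1 | h1
  · exact .inl h1.adj
  · exact h1.1.imp id fun h2 => ⟨h2, h1⟩

theorem removable_of_mt_subset [Finite V] {G D : Digraph V} (hE : IsEssentialGraphOf G D)
    {v w : V} (hvw : D.Adj v w)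
    (hmt : mt (removeBetween G v w) v ⊆ mt (removeBetween G v w) w) : Removable G v w := by
  classical
  cases nonempty_fintype V
  have hD := hE.1
  have hne : ∀ {a b}, D.Adj a b → a ≠ b := by
    rintro a _ h rfl
    exact hD.irrefl h
  have ofDAG : ∀ {D' : Digraph V}, IsDAG D' → MarkovEquiv D D' → D'.Adj v w →
      (∀ s, (∀ t, ¬ D'.Adj t s) → ReflTransGen D'.Adj s v →
        ReflTransGen (delEdge D' v w).Adj s w) → Removable G v w :=
    fun h1 h2 h3 h4 => ⟨_, hE.of_markovEquiv h1 h2, h3, (uncondEquivSep_delEdge_iff h1 h3).2 h4⟩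
  have nreach : ∀ {D' : Digraph V}, IsDAG D' → D'.Adj v w → ∀ {y}, ReflTransGen D'.Adj y v →
      ¬ ReflTransGen D'.Adj w y := fun h1 h2 _ h3 h4 => h1.no_cycle h2 (h4.trans h3)
  have ofPath : ∀ {D' : Digraph V}, IsDAG D' → MarkovEquiv D D' → D'.Adj v w → ∀ u,
      D'.Adj v u → D'.Adj u w → Removable G v w := by
    intro D' h1 h2 h3 u hvu huw
    refine ofDAG h1 h2 h3 fun s _ hsv => ?_
    refine ((reach_delEdge hsv (nreach h1 h3 .refl)).tail ⟨hvu, ?_⟩).tail ⟨huw, ?_⟩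
    · rintro ⟨-, rfl⟩
      exact h1.irrefl huw
    · rintro ⟨rfl, -⟩
      exact h1.irrefl hvu
  have hH : ∀ {a b}, (removeBetween G v w).Adj a b →
      Forced D a b ∨ Free D a b ∧ (removeBetween G v w).Adj b a := by
    intro a b h
    refine (hE.forced_or_free h.1).imp id fun h1 => ⟨h1, hE.adj_of_free h1.symm, fun h2 => h.2 ?_⟩
    tauto
  have mem_mt : ∀ {s}, (∀ y, ¬ Forced D y s) →
      ReflTransGen (removeBetween G v w).Adj s v → s ∈ mt (removeBetween G v w) v := by
    intro s hs hsv
    refine ⟨hsv, Set.Subset.antisymm (fun x hx => ⟨?_, hx⟩) fun x hx => hx.2⟩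
    exact ReflTransGen.mono (fun _ _ h => h.1) _ _ (free_reach_of_reach hD hs hH hx)
  by_cases hf : Forced D v w
  · by_cases hu : ∃ u, Forced D v u ∧ Free D u w
    · obtain ⟨u, hvu, huw⟩ := hu
      obtain ⟨D', h1, h2, h3⟩ := hE.exists_adj_of_free huw
      have hV := h2.sameSkelColl hD h1
      exact ofPath h1 h2 (hf.adj_of_sameSkelColl hD h1 hV) u
        (hvu.adj_of_sameSkelColl hD h1 hV) h3
    refine ofDAG hD (fun _ _ _ _ _ _ => Iff.rfl) hvw fun s hs hsv => ?_
    have hsH : ReflTransGen (removeBetween G v w).Adj s v := by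
      refine ReflTransGen.mono (fun a b h => ⟨hE.adj_of_adj h.1, ?_⟩) _ _
        (reach_delEdge (v := v) hsv (nreach hD hvw .refl))
      rintro (h' | ⟨rfl, rfl⟩)
      · exact h.2 h'
      · exact hD.asymm h.1 hvw
    have hsw := (hmt (mem_mt (fun y hy => hs y hy.adj) hsH)).1
    refine reach_of_source hD hs (H := (removeBetween G v w).Adj) (fun h => h.1) (fun h => ?_)
      (fun {a b} h h' => ?_) hsw
    · rcases hE.forced_or_free h.1 with h1 | h1
      · exact .inl ⟨h1.adj, fun h2 => h.2 (.inl h2)⟩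
      · exact h1.1.imp (fun h2 => ⟨h2, fun h3 => h.2 (.inl h3)⟩)
          fun h2 => ⟨⟨h2, fun h3 => h.2 (.inr h3.symm)⟩, h1⟩
    · obtain ⟨rfl, rfl⟩ : a = v ∧ b = w := by
        by_contra hc
        exact h' ⟨h, hc⟩
      exact ⟨hf, fun u h2 => hu ⟨u, h2⟩⟩
  have hfree : Free D v w := ⟨.inl hvw, hf, fun h => hD.asymm hvw h.adj⟩
  by_cases hp : ∃ y, Forced D y v
  · obtain ⟨y, hy⟩ := hp
    refine ofDAG hD (fun _ _ _ _ _ _ => Iff.rfl) hvw fun s hs hsv => ?_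
    obtain ⟨y', h1, h2⟩ := exists_forced_parent hD hs hsv hy
    exact (reach_delEdge h2 (nreach hD hvw (.single h1.adj))).tail
      ⟨(h1.of_free hD hfree).adj, fun h => hne h1.adj h.1⟩
  · push Not at hp
    have hvw' := (hmt (mem_mt hp .refl)).1
    have hw : ∀ y, ¬ Forced D y w := fun y h => hp y (h.of_free hD hfree.symm)
    have hwv := free_reach_of_reach hD hw hH hvw'
    obtain ⟨t, hwt, htv⟩ := (eliminable_free hD).exists_common (fun _ _ h => h.symm)
      (Free.irrefl hD) hfree.symm Finset.univ (Finset.mem_univ _) (Finset.mem_univ _)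
      (ReflTransGen.mono (fun a b h => ⟨Finset.mem_univ _, h.2, fun h' => h.1.2 h'.symm⟩) _ _ hwv)
    obtain ⟨D', h1, h2, h3, h4, h5⟩ := hE.exists_adj_of_free_triangle htv.symm hwt.symm hfree
    exact ofPath h1 h2 h5 t h3 h4

/-- Let `G` be the essential graph of a Markov equivalence
class of DAGs on a finite vertex set, and let `v ⊸ w` be an edge of `G`
(directed `v → w` or undirected; in the encoding, `G.Adj v w`).  Then
`v ⊸ w` is removable in `G` iff
`mt_{G − v⊸w}(v) ⊆ mt_{G − v⊸w}(w)`. -/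
theorem removable_iff_mt_subset [Fintype V] (G : Digraph V)
    (hG : ∃ D : Digraph V, IsEssentialGraphOf G D)
    (v w : V) (hvw : v ≠ w) (he : G.Adj v w) :
    Removable G v w ↔
      mt (removeBetween G v w) v ⊆ mt (removeBetween G v w) w := by
  constructor
  · rintro ⟨D, hE, hD, hU⟩
    exact removable_imp_mt_subset hE hD hU
  · intro h
    obtain ⟨D, hE⟩ := hG
    obtain ⟨D', h1, h2, h3⟩ := (hE.2 v w).1 he
    exact removable_of_mt_subset (hE.of_markovEquiv h1 h2) h3 h

end UEC
end
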